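/- arXiv:1806.04538 — 4 statements merged into one kernel-verified Lean document; each statement's English description precedes it below -/
import Mathlib

section
/- If k is a perfect field of characteristic p ≥ 5 and n ≥ 2, then the generic determinantal ring A = k[[X]]/I_{n−1}(X) is strongly F-regular. -/
/-- `𝔞^{[q]}`: the ideal generated by the `q`-th powers of all elements of `𝔞`. -/
def frobPow {R : Type} [CommRing R] (q : ℕ) (a : Ideal R) : Ideal R :=
  Ideal.span ((fun x => x ^ q) '' (a : Set R))

/-- For the generic `n × (n-1)` matrix `X` (with `n = m + 2`) over `R = k[[X]]`,
`Gmin k m i` is the maximal minor obtained by deleting the `i`-th row. -/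
noncomputable def Gmin (k : Type) [Field k] (m : ℕ) (i : Fin (m + 2)) :
    MvPowerSeries (Fin (m + 2) × Fin (m + 1)) k :=
  (Matrix.of fun r c : Fin (m + 1) =>
    (MvPowerSeries.X (i.succAbove r, c) : MvPowerSeries (Fin (m + 2) × Fin (m + 1)) k)).det

/-- `gmin k m j` is the `(n-2) × (n-2)` minor of the submatrix `X'` formed by the first
`n - 2` rows of `X`, obtained by deleting the `j`-th column. -/
noncomputable def gmin (k : Type) [Field k] (m : ℕ) (j : Fin (m + 1)) :
    MvPowerSeries (Fin (m + 2) × Fin (m + 1)) k :=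
  (Matrix.of fun r c : Fin m =>
    (MvPowerSeries.X (Fin.castAdd 2 r, j.succAbove c) :
      MvPowerSeries (Fin (m + 2) × Fin (m + 1)) k)).det

/-- `I = I_{n-1}(X)`, the ideal of maximal minors. -/
noncomputable def Imax (k : Type) [Field k] (m : ℕ) :
    Ideal (MvPowerSeries (Fin (m + 2) × Fin (m + 1)) k) :=
  Ideal.span (Set.range (Gmin k m))

/-- `P = I_{n-2}(X')` (equal to `R` when `n = 2`). -/
noncomputable def Psub (k : Type) [Field k] (m : ℕ) :
    Ideal (MvPowerSeries (Fin (m + 2) × Fin (m + 1)) k) :=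
  Ideal.span (Set.range (gmin k m))

/-- `Ω = I + P`. -/
noncomputable def Omeg (k : Type) [Field k] (m : ℕ) :
    Ideal (MvPowerSeries (Fin (m + 2) × Fin (m + 1)) k) :=
  Imax k m ⊔ Psub k m


/-- `A` is strongly `F`-regular: for every `c` not in any minimal prime there are `e ≥ 1` and
an additive map `ψ : A → A` with `ψ (a^{p^e} x) = a ψ(x)` and `ψ c = 1`. -/
def StronglyFRegular (p : ℕ) (A : Type) [CommRing A] : Prop :=
  ∀ c : A, (∀ P ∈ minimalPrimes A, c ∉ P) →
    ∃ (e : ℕ) (ψ : A →+ A), 1 ≤ e ∧ (∀ a x : A, ψ (a ^ p ^ e * x) = a * ψ x) ∧ ψ c = 1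

/-- An additive map `ψ` is `q`-root linear if `ψ (a ^ q * x) = a * ψ x`; these are the
`A`-linear maps `F_* A → A` when `q` is a power of the characteristic. -/
def IsRootLinear {A : Type*} [CommRing A] (q : ℕ) (ψ : A →+ A) : Prop :=
  ∀ a x : A, ψ (a ^ q * x) = a * ψ x

namespace IsRootLinear

variable {A : Type*} [CommRing A] {q q' : ℕ} {ψ ψ' : A →+ A}

theorem comp (h : IsRootLinear q ψ) (h' : IsRootLinear q' ψ') :
    IsRootLinear (q * q') (ψ.comp ψ') := fun a x => by
  rw [AddMonoidHom.comp_apply, pow_mul, h', h, AddMonoidHom.comp_apply]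

theorem mulLeft_comp (h : IsRootLinear q ψ) (b : A) :
    IsRootLinear q ((AddMonoidHom.mulLeft b).comp ψ) := fun a x => by
  simp only [AddMonoidHom.comp_apply, AddMonoidHom.coe_mulLeft, h a x]
  ring

theorem comp_mulLeft (h : IsRootLinear q ψ) (b : A) :
    IsRootLinear q (ψ.comp (AddMonoidHom.mulLeft b)) := fun a x => by
  simp only [AddMonoidHom.comp_apply, AddMonoidHom.coe_mulLeft]
  rw [mul_left_comm, h]

theorem add (h : IsRootLinear q ψ) (h' : IsRootLinear q ψ') : IsRootLinear q (ψ + ψ') :=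
  fun a x => by simp only [AddMonoidHom.add_apply, h a x, h' a x, mul_add]

theorem zero : IsRootLinear q (0 : A →+ A) := fun a x => by simp

end IsRootLinear

/-- The ideal of values at `d` of the `q`-root linear maps. -/
def rootIdeal {A : Type*} [CommRing A] (q : ℕ) (d : A) : Ideal A where
  carrier := {y | ∃ ψ : A →+ A, IsRootLinear q ψ ∧ ψ d = y}
  add_mem' := by
    rintro _ _ ⟨ψ, h, rfl⟩ ⟨ψ', h', rfl⟩
    exact ⟨ψ + ψ', h.add h', rfl⟩
  zero_mem' := ⟨0, .zero, rfl⟩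
  smul_mem' := by
    rintro c _ ⟨ψ, h, rfl⟩
    exact ⟨_, h.mulLeft_comp c, rfl⟩

theorem isReduced_of_isRootLinear {A : Type*} [CommRing A] {q : ℕ} (hq : 1 < q) {ψ : A →+ A}
    (h : IsRootLinear q ψ) {c : A} (hc : ψ c = 1) : IsReduced A := by
  rw [isReduced_iff_pow_one_lt q hq]
  intro x hx
  have := h x c
  simpa [hx, hc] using this.symm

theorem mul_left_cancel_of_notMem_minimalPrimes {A : Type*} [CommRing A] [IsReduced A] {d : A}
    (hd : ∀ P ∈ minimalPrimes A, d ∉ P) {x : A} (hx : x * d = 0) : x = 0 := by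
  have : x ∈ sInf (minimalPrimes A) := by
    rw [Ideal.mem_sInf]
    intro P hP
    have hp : P.IsPrime := hP.1.1
    refine (hp.mem_or_mem (?_ : x * d ∈ P)).resolve_right (hd P hP)
    rw [hx]; exact P.zero_mem
  rw [minimalPrimes, Ideal.sInf_minimalPrimes] at this
  obtain ⟨n, hn⟩ := this
  exact eq_zero_of_pow_eq_zero (by simpa using hn)

/-- Iterating a root linear map which sends `g` to `1`, one reaches every power of `g`. -/
theorem exists_isRootLinear_pow {A : Type*} [CommRing A] {q : ℕ} (hq : 1 ≤ q) {ψ : A →+ A}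
    (h : IsRootLinear q ψ) {g : A} (hg : ψ g = 1) (N : ℕ) :
    ∃ (s : ℕ) (χ : A →+ A), IsRootLinear (q ^ s) χ ∧ χ (g ^ N) = 1 := by
  have key : ∀ s : ℕ, ∃ M, s ≤ M ∧ ∃ χ : A →+ A, IsRootLinear (q ^ s) χ ∧ χ (g ^ M) = 1 := by
    intro s
    induction s with
    | zero => exact ⟨0, le_rfl, AddMonoidHom.id A, fun a x => by simp, by simp⟩
    | succ s ih =>
      obtain ⟨M, hM, χ, hχ, h1⟩ := ih
      refine ⟨M * q + 1, ?_, χ.comp ψ, ?_, ?_⟩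
      · have := Nat.le_mul_of_pos_right M hq
        omega
      · exact hχ.comp h
      · rw [AddMonoidHom.comp_apply, pow_succ, pow_mul, h, hg, mul_one, h1]
  obtain ⟨M, hM, χ, hχ, h1⟩ := key N
  refine ⟨N, _, hχ.comp_mulLeft (g ^ (M - N)), ?_⟩
  simp only [AddMonoidHom.comp_apply, AddMonoidHom.coe_mulLeft]
  rw [← pow_add, Nat.sub_add_cancel hM, h1]

theorem exists_pow_mem_rootIdeal {A : Type*} [CommRing A] [IsNoetherianRing A] {p : ℕ}
    (hp : 1 < p) (g : A) (N : ℕ)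
    (H : ∀ (e : ℕ) (d : A), g ^ (N * p ^ e) * d ∈
      Ideal.span ((fun y => y ^ p ^ e) '' (rootIdeal (p ^ e) d : Set A)))
    {d : A} (hd : ∀ x, x * d = 0 → x = 0) :
    ∃ e M, 1 ≤ e ∧ g ^ M ∈ rootIdeal (p ^ e) d := by
  let L := Localization.Away g
  let J : ℕ → Ideal L := fun e => (rootIdeal (p ^ e) d).map (algebraMap A L)
  have hunit : ∀ M, IsUnit (algebraMap A L (g ^ M)) := fun M => by
    rw [map_pow]
    exact (IsLocalization.Away.algebraMap_isUnit g).pow M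
  have hmono : Monotone J := by
    refine monotone_nat_of_le_succ fun e => Ideal.map_le_iff_le_comap.2 ?_
    rintro _ ⟨ψ, hψ, rfl⟩
    have aux : ∀ w ∈ Ideal.span ((fun y => y ^ p ^ (e + 1)) ''
        (rootIdeal (p ^ (e + 1)) d : Set A)), ∀ c, ψ (c * w) ∈ rootIdeal (p ^ (e + 1)) d := by
      intro w hw
      refine Submodule.span_induction ?_ ?_ ?_ ?_ hw
      · rintro _ ⟨z, hz, rfl⟩ c
        have : c * z ^ p ^ (e + 1) = (z ^ p) ^ p ^ e * c := by
          rw [← pow_mul, pow_succ' p e, mul_comm]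
        simp only [this, hψ (z ^ p) c]
        exact Ideal.mul_mem_right _ _ (Ideal.pow_mem_of_mem _ hz _ (by omega))
      · intro c; simp
      · intro x y _ _ hx hy c
        rw [mul_add, map_add]
        exact add_mem (hx c) (hy c)
      · intro a x _ hx c
        rw [smul_eq_mul, ← mul_assoc]
        exact hx _
    have h1 := aux _ (H (e + 1) d) 1
    have h2 : 1 * (g ^ (N * p ^ (e + 1)) * d) = (g ^ (N * p)) ^ p ^ e * d := by
      rw [one_mul, ← pow_mul, pow_succ', mul_assoc]
    rw [h2, hψ] at h1
    have h3 := Ideal.mem_map_of_mem (algebraMap A L) h1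
    rw [map_mul] at h3
    exact (Ideal.unit_mul_mem_iff_mem _ (hunit _)).1 h3
  obtain ⟨E, hE⟩ := monotone_stabilizes_iff_noetherian.2
    (inferInstance : IsNoetherian L L) ⟨J, hmono⟩
  have hE' : ∀ e, E ≤ e → J E = J e := hE
  have hmem : algebraMap A L d ∈ (⨅ i : ℕ, J (E + 1) ^ i • (⊤ : Submodule L L)) := by
    rw [Submodule.mem_iInf]
    intro i
    rw [smul_eq_mul, Ideal.mul_top]
    have h1 : algebraMap A L (g ^ (N * p ^ (E + 1 + i)) * d) ∈ J (E + 1) ^ p ^ (E + 1 + i) := by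
      have : J (E + 1) = J (E + 1 + i) := (hE' _ (by omega)).symm.trans (hE' _ (by omega))
      rw [this]; show _ ∈ (Ideal.map _ _) ^ _; rw [← Ideal.map_pow]
      refine Ideal.mem_map_of_mem _ (Ideal.span_le.2 ?_ (H _ d))
      rintro _ ⟨y, hy, rfl⟩
      exact Ideal.pow_mem_pow hy _
    rw [map_mul, Ideal.unit_mul_mem_iff_mem _ (hunit _)] at h1
    exact Ideal.pow_le_pow_right (by have := Nat.lt_pow_self hp (n := E + 1 + i); omega) h1
  rw [Ideal.mem_iInf_smul_pow_eq_bot_iff] at hmem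
  obtain ⟨⟨r, hr⟩, hrd⟩ := hmem
  have hr1 : r = 1 := by
    have h0 : (r - 1) * algebraMap A L d = 0 := by
      have : r * algebraMap A L d = algebraMap A L d := hrd
      rw [sub_mul, this, one_mul, sub_self]
    obtain ⟨⟨x, ⟨y, hy⟩⟩, hxy⟩ := IsLocalization.surj (Submonoid.powers g) (r - 1)
    simp only at hxy
    have h2 : algebraMap A L (x * d) = 0 := by
      rw [map_mul, ← hxy, mul_right_comm, h0, zero_mul]
    rw [IsLocalization.map_eq_zero_iff (Submonoid.powers g)] at h2
    obtain ⟨c, hc⟩ := h2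
    have h3 := hd (c * x) (by rw [mul_assoc, hc])
    have h4 : algebraMap A L x = 0 :=
      (IsLocalization.map_eq_zero_iff (Submonoid.powers g) L x).2 ⟨c, h3⟩
    rw [h4] at hxy
    have := (IsLocalization.map_units L (⟨y, hy⟩ : Submonoid.powers g)).mul_left_eq_zero.1 hxy
    exact sub_eq_zero.1 this
  rw [hr1] at hr
  have h1 : algebraMap A L 1 ∈ J (E + 1) := by rwa [map_one]
  rw [IsLocalization.algebraMap_mem_map_algebraMap_iff (Submonoid.powers g)] at h1
  obtain ⟨_, ⟨M, rfl⟩, hM⟩ := h1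
  exact ⟨E + 1, M, by omega, by simpa using hM⟩

theorem stronglyFRegular_of_rootIdeal {A : Type} [CommRing A] [IsNoetherianRing A] {p : ℕ}
    (hp : 1 < p) (g : A) (N : ℕ)
    (H : ∀ (e : ℕ) (d : A), g ^ (N * p ^ e) * d ∈
      Ideal.span ((fun y => y ^ p ^ e) '' (rootIdeal (p ^ e) d : Set A)))
    {ψ : A →+ A} (hψ : IsRootLinear p ψ) (hg : ψ g = 1) : StronglyFRegular p A := by
  intro d hd
  have := isReduced_of_isRootLinear hp hψ hg
  obtain ⟨e, M, he, χ, hχ, hM⟩ := exists_pow_mem_rootIdeal hp g N H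
    (d := d) fun x hx => mul_left_cancel_of_notMem_minimalPrimes hd hx
  obtain ⟨s, ω, hω, h1⟩ := exists_isRootLinear_pow hp.le hψ hg M
  refine ⟨s + e, ω.comp χ, by omega, ?_, ?_⟩
  · rw [pow_add]
    exact hω.comp hχ
  · rw [AddMonoidHom.comp_apply, hM, h1]

namespace MvPowerSeries

section RootCoeff

variable {σ k : Type*} [Field k] (p e : ℕ) [ExpChar k p]

theorem coeff_smul_pow_expChar_pow (a : MvPowerSeries σ k) (α : σ →₀ ℕ) :
    coeff (p ^ e • α) (a ^ p ^ e) = coeff α a ^ p ^ e := by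
  rw [← map_iterateFrobenius_expand p (expChar_ne_zero k p), coeff_map, coeff_expand_smul,
    iterateFrobenius_def]

theorem coeff_pow_expChar_pow_of_not_dvd (a : MvPowerSeries σ k) {μ : σ →₀ ℕ} {s : σ}
    (h : ¬ p ^ e ∣ μ s) : coeff μ (a ^ p ^ e) = 0 := by
  rw [← map_iterateFrobenius_expand p (expChar_ne_zero k p), coeff_map,
    coeff_expand_of_not_dvd _ _ _ h, map_zero]

variable [PerfectRing k p]

/-- The coefficient of the monomial with exponent `β` in the expansion of a power series in the
basis of monomials over the subring of `p ^ e`-th powers, followed by extraction of the root. -/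
noncomputable def rootCoeff (β : σ →₀ ℕ) : MvPowerSeries σ k →+ MvPowerSeries σ k where
  toFun f := fun α => (iterateFrobeniusEquiv k p e).symm (coeff (p ^ e • α + β) f)
  map_zero' := by
    funext α
    change (iterateFrobeniusEquiv k p e).symm (coeff (p ^ e • α + β) 0) = 0
    rw [map_zero, map_zero]
  map_add' f g := by
    funext α
    change (iterateFrobeniusEquiv k p e).symm (coeff (p ^ e • α + β) (f + g)) = _
    rw [map_add, map_add]
    rfl

theorem coeff_rootCoeff (β : σ →₀ ℕ) (f : MvPowerSeries σ k) (α : σ →₀ ℕ) :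
    coeff α (rootCoeff p e β f) =
      (iterateFrobeniusEquiv k p e).symm (coeff (p ^ e • α + β) f) := rfl

theorem coeff_rootCoeff_pow (β : σ →₀ ℕ) (f : MvPowerSeries σ k) (α : σ →₀ ℕ) :
    coeff α (rootCoeff p e β f) ^ p ^ e = coeff (p ^ e • α + β) f := by
  rw [coeff_rootCoeff, ← iterateFrobeniusEquiv_def, RingEquiv.apply_symm_apply]

theorem isRootLinear_rootCoeff {β : σ →₀ ℕ} (hβ : ∀ s, β s < p ^ e) :
    IsRootLinear (p ^ e) (rootCoeff (k := k) p e β) := by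
  classical
  intro a f
  have hq : p ^ e ≠ 0 := pow_ne_zero _ (expChar_ne_zero k p)
  ext α
  rw [coeff_rootCoeff, RingEquiv.symm_apply_eq, iterateFrobeniusEquiv_def, coeff_mul, coeff_mul,
    ← iterateFrobenius_def (R := k), map_sum]
  symm
  refine Finset.sum_of_injOn (fun x => (p ^ e • x.1, p ^ e • x.2 + β)) ?_ ?_ ?_ ?_
  · rintro ⟨x, y⟩ - ⟨x', y'⟩ - h
    simp only [Prod.mk.injEq, add_left_inj, nsmul_right_inj hq] at h
    exact Prod.ext h.1 h.2
  · rintro ⟨x, y⟩ h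
    simp only [SetLike.mem_coe, Finset.HasAntidiagonal.mem_antidiagonal] at h ⊢
    rw [← h, smul_add, add_assoc]
  · rintro ⟨γ, δ⟩ h hn
    rw [Finset.HasAntidiagonal.mem_antidiagonal] at h
    by_cases hd : ∀ s, p ^ e ∣ γ s
    · exfalso
      apply hn
      have hle : ∀ s, γ s / p ^ e ≤ α s := fun s => by
        have h1 := DFunLike.congr_fun h s
        simp only [Finsupp.coe_add, Finsupp.coe_smul, Pi.add_apply, Pi.smul_apply,
          smul_eq_mul] at h1
        rw [← Nat.lt_succ_iff, Nat.div_lt_iff_lt_mul (Nat.pos_of_ne_zero hq), Nat.succ_mul,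
          mul_comm]
        have := hβ s
        omega
      let γ' : σ →₀ ℕ := γ.mapRange (· / p ^ e) (Nat.zero_div _)
      have hγ : p ^ e • γ' = γ := by
        ext s
        simpa [γ'] using Nat.mul_div_cancel' (hd s)
      have hle' : γ' ≤ α := fun s => by simpa [γ'] using hle s
      refine ⟨(γ', α - γ'), by simp [add_tsub_cancel_of_le hle'], ?_⟩
      refine Prod.ext hγ ?_
      have h2 : γ + (p ^ e • (α - γ') + β) = γ + δ := by
        rw [h, ← add_assoc]
        conv_lhs => rw [← hγ]
        rw [← smul_add, add_tsub_cancel_of_le hle']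
      exact add_left_cancel h2
    · push Not at hd
      obtain ⟨s, hs⟩ := hd
      simp only
      rw [coeff_pow_expChar_pow_of_not_dvd p e a hs, zero_mul]
  · rintro ⟨γ, δ⟩ -
    simp only
    rw [map_mul, iterateFrobenius_def, iterateFrobenius_def, coeff_rootCoeff_pow,
      coeff_smul_pow_expChar_pow]

/-- The exponent with entries `β s`. -/
noncomputable def boxExp {σ : Type*} [Finite σ] {q : ℕ} (β : σ → Fin q) : σ →₀ ℕ :=
  Finsupp.equivFunOnFinite.symm fun s => (β s : ℕ)

@[simp]
theorem boxExp_apply {σ : Type*} [Finite σ] {q : ℕ} (β : σ → Fin q) (s : σ) :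
    boxExp β s = β s := rfl

theorem sum_rootCoeff_pow_mul_monomial [Fintype σ] [DecidableEq σ] (f : MvPowerSeries σ k) :
    ∑ β : σ → Fin (p ^ e), rootCoeff p e (boxExp β) f ^ p ^ e * monomial (boxExp β) 1 = f := by
  have hq : 0 < p ^ e := Nat.pos_of_ne_zero (pow_ne_zero _ (expChar_ne_zero k p))
  ext μ
  rw [map_sum]
  let β₀ : σ → Fin (p ^ e) := fun s => ⟨μ s % p ^ e, Nat.mod_lt _ hq⟩
  let α : σ →₀ ℕ := μ.mapRange (· / p ^ e) (Nat.zero_div _)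
  have hμ : μ = p ^ e • α + boxExp β₀ := by
    ext s
    simpa [α, β₀] using (Nat.div_add_mod (μ s) (p ^ e)).symm
  rw [Finset.sum_eq_single β₀]
  · rw [coeff_mul_monomial, mul_one, if_pos (by rw [hμ]; exact le_add_self)]
    conv_rhs => rw [hμ]
    have : μ - boxExp β₀ = p ^ e • α := by rw [hμ, add_tsub_cancel_right]
    rw [this, coeff_smul_pow_expChar_pow, coeff_rootCoeff_pow]
  · intro β _ hβ
    rw [coeff_mul_monomial, mul_one]
    split_ifs with hle
    · obtain ⟨s, hs⟩ := Function.ne_iff.1 hβ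
      refine coeff_pow_expChar_pow_of_not_dvd p e _ (s := s) fun hd => hs ?_
      have h1 : (β s : ℕ) ≤ μ s := hle s
      have h2 : p ^ e ∣ μ s - β s := hd
      have h3 := (Nat.modEq_iff_dvd' h1).2 h2
      refine Fin.ext ?_
      rw [Nat.ModEq, Nat.mod_eq_of_lt (β s).2] at h3
      exact h3
    · rfl
  · simp

end RootCoeff

section FreeOf

variable {σ k : Type*} [Field k]

/-- The subring of power series which do not involve the variable `v`. -/
def freeOf (k : Type*) [Field k] (v : σ) : Subring (MvPowerSeries σ k) where
  carrier := {f | ∀ α : σ →₀ ℕ, α v ≠ 0 → coeff α f = 0}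
  zero_mem' := fun α _ => by simp
  one_mem' := fun α h => by
    classical
    rw [coeff_one, if_neg]
    rintro rfl
    exact h rfl
  add_mem' := fun {f g} hf hg α h => by rw [map_add, hf α h, hg α h, add_zero]
  neg_mem' := fun {f} hf α h => by rw [map_neg, hf α h, neg_zero]
  mul_mem' := fun {f g} hf hg α h => by
    classical
    rw [coeff_mul]
    refine Finset.sum_eq_zero ?_
    rintro ⟨x, y⟩ hxy
    rw [Finset.HasAntidiagonal.mem_antidiagonal] at hxy
    by_cases hx : x v = 0
    · have hy : y v ≠ 0 := by
        intro hy
        apply h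
        rw [← hxy, Finsupp.add_apply, hx, hy]
      rw [hg y hy, mul_zero]
    · rw [hf x hx, zero_mul]

theorem monomial_mem_freeOf {v : σ} {α : σ →₀ ℕ} (h : α v = 0) (c : k) :
    monomial α c ∈ freeOf k v := by
  classical
  intro β hβ
  rw [coeff_monomial, if_neg]
  rintro rfl
  exact hβ h

theorem X_mem_freeOf {v w : σ} (h : w ≠ v) : (X w : MvPowerSeries σ k) ∈ freeOf k v := by
  classical
  exact monomial_mem_freeOf (by simp [h]) 1

variable (p e : ℕ) [ExpChar k p] [PerfectRing k p]

theorem rootCoeff_eq_zero_of_mem_freeOf {v : σ} {f : MvPowerSeries σ k} (hf : f ∈ freeOf k v)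
    {β : σ →₀ ℕ} (hβ : β v ≠ 0) : rootCoeff p e β f = 0 := by
  ext α
  rw [coeff_rootCoeff, hf, map_zero, map_zero]
  simp [hβ]

theorem rootCoeff_X_pow_mul_eq_zero {v : σ} {f : MvPowerSeries σ k} (hf : f ∈ freeOf k v)
    {β : σ →₀ ℕ} {j : ℕ} (hj : j < β v) : rootCoeff p e β (X v ^ j * f) = 0 := by
  classical
  ext α
  rw [coeff_rootCoeff, X_pow_eq, coeff_monomial_mul]
  split_ifs with h
  · rw [hf, mul_zero, map_zero, map_zero]
    simp only [Finsupp.coe_tsub, Finsupp.coe_add, Pi.sub_apply, Pi.add_apply,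
      Finsupp.single_eq_same]
    omega
  · rw [map_zero, map_zero]

theorem rootCoeff_linear_pow_mul {v : σ} {g s f : MvPowerSeries σ k} (hg : g ∈ freeOf k v)
    (hs : s ∈ freeOf k v) (hf : f ∈ freeOf k v) {β : σ →₀ ℕ} {N : ℕ} (hβ : β v = N) :
    rootCoeff p e β ((X v * g + s) ^ N * f) = rootCoeff p e β (X v ^ N * (g ^ N * f)) := by
  rw [add_pow, Finset.sum_range_succ, add_mul, map_add, Finset.sum_mul, map_sum,
    Finset.sum_eq_zero, zero_add, Nat.sub_self, pow_zero, Nat.choose_self, mul_pow]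
  · congr 1
    push_cast
    ring
  · intro j hj
    rw [Finset.mem_range] at hj
    have : (X v * g) ^ j * s ^ (N - j) * (N.choose j : MvPowerSeries σ k) * f =
        X v ^ j * (g ^ j * s ^ (N - j) * (N.choose j : MvPowerSeries σ k) * f) := by ring
    rw [this]
    refine rootCoeff_X_pow_mul_eq_zero p e ?_ (hβ ▸ hj)
    exact mul_mem (mul_mem (mul_mem (pow_mem hg _) (pow_mem hs _)) (natCast_mem _ _)) hf

end FreeOf

end MvPowerSeries

section Linkage

open Matrix

variable {S n : Type*} [CommRing S] [Fintype n] [DecidableEq n]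

/-- The ideal of maximal minors of the matrix obtained from the square matrix `M` by adding the
row `r`: it is generated by `det M` and the determinants of `M` with one row replaced by `r`. -/
def borderIdeal (M : Matrix n n S) (r : n → S) : Ideal S :=
  Ideal.span (insert M.det (Set.range (r ᵥ* M.adjugate)))

theorem det_mem_borderIdeal (M : Matrix n n S) (r : n → S) : M.det ∈ borderIdeal M r :=
  Ideal.subset_span (Set.mem_insert _ _)

theorem vecMul_adjugate_mem_borderIdeal (M : Matrix n n S) (r : n → S) (l : n) :
    (r ᵥ* M.adjugate) l ∈ borderIdeal M r :=
  Ideal.subset_span (Set.mem_insert_of_mem _ ⟨l, rfl⟩)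

/-- The `2 × 2` minors of the adjugate are divisible by the determinant. -/
theorem adjugate_mul_adjugate_sub (M : Matrix n n S) (i j l l₀ : n) :
    ∃ c, M.adjugate j l₀ * M.adjugate i l = M.det * c + M.adjugate i l₀ * M.adjugate j l := by
  set N := M.updateRow l₀ (Pi.single j 1) with hN
  have h1 : N * M.adjugate = (M.det • (1 : Matrix n n S)).updateRow l₀ (M.adjugate j) := by
    rw [hN, updateRow_mul, mul_adjugate, single_one_vecMul]
    rfl
  have h2 : N.adjugate * (N * M.adjugate) = M.adjugate j l₀ • M.adjugate := by
    rw [← Matrix.mul_assoc, adjugate_mul, smul_mul_assoc, one_mul, adjugate_apply M j l₀]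
  have h3 := congrFun (congrFun h2 i) l
  rw [h1, mul_apply, Matrix.smul_apply, smul_eq_mul,
    ← Finset.add_sum_erase _ _ (Finset.mem_univ l₀), updateRow_self] at h3
  have h4 : N.adjugate i l₀ = M.adjugate i l₀ := by
    rw [adjugate_apply, adjugate_apply, hN, updateRow_idem]
  refine ⟨∑ k ∈ Finset.univ.erase l₀, N.adjugate i k * (1 : Matrix n n S) k l, ?_⟩
  rw [← h3, h4, add_comm, Finset.mul_sum]
  congr 1
  refine Finset.sum_congr rfl fun k hk => ?_
  rw [updateRow_ne (Finset.ne_of_mem_erase hk), Matrix.smul_apply, smul_eq_mul]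
  ring

theorem adjugate_mul_mem_span_pair (M : Matrix n n S) (r : n → S) (j l₀ : n) {z : S}
    (hz : z ∈ borderIdeal M r) :
    M.adjugate j l₀ * z ∈ Ideal.span {M.det, (r ᵥ* M.adjugate) l₀} := by
  have hD : M.det ∈ Ideal.span {M.det, (r ᵥ* M.adjugate) l₀} :=
    Ideal.subset_span (Set.mem_insert _ _)
  have hE : (r ᵥ* M.adjugate) l₀ ∈ Ideal.span {M.det, (r ᵥ* M.adjugate) l₀} :=
    Ideal.subset_span (Set.mem_insert_of_mem _ rfl)
  refine Submodule.span_induction ?_ (by simp) ?_ ?_ hz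
  · rintro _ (rfl | ⟨l, rfl⟩)
    · exact Ideal.mul_mem_left _ _ hD
    · choose c hc using fun i => adjugate_mul_adjugate_sub M i j l l₀
      have : M.adjugate j l₀ * (r ᵥ* M.adjugate) l =
          M.det * (∑ i, r i * c i) + (r ᵥ* M.adjugate) l₀ * M.adjugate j l := by
        simp only [vecMul, dotProduct, Finset.mul_sum, Finset.sum_mul]
        rw [← Finset.sum_add_distrib]
        refine Finset.sum_congr rfl fun i _ => ?_
        linear_combination r i * hc i
      rw [this]
      exact add_mem (Ideal.mul_mem_right _ _ hD) (Ideal.mul_mem_right _ _ hE)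
  · intro x y _ _ hx hy
    rw [mul_add]
    exact add_mem hx hy
  · intro a x _ hx
    rw [smul_eq_mul, mul_left_comm]
    exact Ideal.mul_mem_left _ _ hx

/-- The linkage formula `(det M, E) : (column l₀ of adj M) ⊆ borderIdeal M r`, where `E` is the
determinant of `M` with row `l₀` replaced by `r`. -/
theorem mem_borderIdeal_of_adjugate_mul_mem [IsDomain S] (M : Matrix n n S) (r : n → S) (l₀ : n)
    (hD : M.det ≠ 0) (hDE : ∀ x, M.det ∣ (r ᵥ* M.adjugate) l₀ * x → M.det ∣ x) {h : S}
    (hh : ∀ j, M.adjugate j l₀ * h ∈ Ideal.span {M.det, (r ᵥ* M.adjugate) l₀}) :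
    h ∈ borderIdeal M r := by
  simp only [Ideal.mem_span_pair] at hh
  choose a b hab using hh
  set D := M.det
  set E := (r ᵥ* M.adjugate) l₀ with hE
  have hpair : ∀ v : n → S, (∑ j, v j * M.adjugate j l₀) * h =
      (v ⬝ᵥ a) * D + (v ⬝ᵥ b) * E := fun v => by
    simp only [dotProduct, Finset.sum_mul]
    rw [← Finset.sum_add_distrib]
    refine Finset.sum_congr rfl fun j _ => ?_
    linear_combination - v j * hab j
  have hM : ∀ i, D ∣ (M *ᵥ b) i := fun i => by
    refine hDE _ ?_
    have h1 := hpair (M i)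
    have h2 : ∑ j, M i j * M.adjugate j l₀ = D * (1 : Matrix n n S) i l₀ := by
      rw [← mul_apply, mul_adjugate, Matrix.smul_apply, smul_eq_mul]
    rw [h2] at h1
    refine ⟨(1 : Matrix n n S) i l₀ * h - M i ⬝ᵥ a, ?_⟩
    change E * (M i ⬝ᵥ b) = _
    linear_combination -h1
  choose c hc using hM
  have hb : b = M.adjugate *ᵥ c := by
    have h1 : M *ᵥ b = D • c := funext fun i => hc i
    have h2 := congrArg (M.adjugate *ᵥ ·) h1
    simp only [mulVec_mulVec, adjugate_mul, smul_mulVec, one_mulVec, mulVec_smul] at h2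
    exact smul_right_injective _ hD h2
  have hr : D ∣ h - r ⬝ᵥ b := by
    refine hDE _ ⟨r ⬝ᵥ a, ?_⟩
    have h1 := hpair r
    have h2 : ∑ j, r j * M.adjugate j l₀ = E := rfl
    rw [h2] at h1
    linear_combination h1
  obtain ⟨t, ht⟩ := hr
  have : h = D * t + ∑ l, (r ᵥ* M.adjugate) l * c l := by
    have h1 : r ⬝ᵥ b = ∑ l, (r ᵥ* M.adjugate) l * c l := by
      rw [hb, dotProduct_mulVec]
      rfl
    rw [← h1, ← ht]
    ring
  rw [this]
  exact add_mem (Ideal.mul_mem_right _ _ (det_mem_borderIdeal M r))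
    (Ideal.sum_mem _ fun l _ => Ideal.mul_mem_right _ _ (vecMul_adjugate_mem_borderIdeal M r l))

theorem borderIdeal_map {T : Type*} [CommRing T] (φ : S →+* T) (M : Matrix n n S) (r : n → S) :
    borderIdeal (M.map φ) (φ ∘ r) = (borderIdeal M r).map φ := by
  have h : ∀ l, ((φ ∘ r) ᵥ* (M.map φ).adjugate) l = φ ((r ᵥ* M.adjugate) l) := fun l => by
    have := φ.map_adjugate M
    rw [RingHom.mapMatrix_apply, RingHom.mapMatrix_apply] at this
    rw [← this, RingHom.map_vecMul]
  rw [borderIdeal, borderIdeal, Ideal.map_span, Set.image_insert_eq, ← Set.range_comp,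
    φ.map_det]
  congr 2
  exact congrArg _ (funext h)

/-- `(det M * E) ^ (q - 1)` multiplies the ideal of maximal minors into its Frobenius power. -/
theorem pow_mul_mem_map_iterateFrobenius [IsDomain S] (p e : ℕ) [ExpChar S p]
    (M : Matrix n n S) (r : n → S) (l₀ : n) (hD : M.det ≠ 0)
    (hDE : ∀ x, M.det ^ p ^ e ∣ (r ᵥ* M.adjugate) l₀ ^ p ^ e * x → M.det ^ p ^ e ∣ x) {z : S}
    (hz : z ∈ borderIdeal M r) :
    (M.det * (r ᵥ* M.adjugate) l₀) ^ (p ^ e - 1) * z ∈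
      (borderIdeal M r).map (iterateFrobenius S p e) := by
  have hq : 0 < p ^ e := Nat.pos_of_ne_zero (pow_ne_zero _ (expChar_ne_zero S p))
  set φ := iterateFrobenius S p e with hφ
  have hadj : (M.map φ).adjugate = M.adjugate.map φ := by
    have := φ.map_adjugate M
    rw [RingHom.mapMatrix_apply, RingHom.mapMatrix_apply] at this
    exact this.symm
  have hdet : (M.map φ).det = M.det ^ p ^ e := (φ.map_det M).symm
  have hE : ((φ ∘ r) ᵥ* (M.map φ).adjugate) l₀ = (r ᵥ* M.adjugate) l₀ ^ p ^ e := by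
    rw [hadj, ← RingHom.map_vecMul, hφ, iterateFrobenius_def]
  rw [← borderIdeal_map]
  refine mem_borderIdeal_of_adjugate_mul_mem _ _ l₀ ?_ ?_ ?_
  · rw [hdet]
    exact pow_ne_zero _ hD
  · rw [hdet, hE]
    exact hDE
  · intro j
    rw [hdet, hE, hadj, Matrix.map_apply, hφ, iterateFrobenius_def]
    obtain ⟨x, y, hxy⟩ := Ideal.mem_span_pair.1 (adjugate_mul_mem_span_pair M r j l₀ hz)
    obtain ⟨q, hq'⟩ : ∃ q, p ^ e = q + 1 := ⟨p ^ e - 1, by omega⟩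
    rw [hq', Nat.add_sub_cancel, Ideal.mem_span_pair]
    refine ⟨M.adjugate j l₀ ^ q * (r ᵥ* M.adjugate) l₀ ^ q * x,
      M.adjugate j l₀ ^ q * M.det ^ q * y, ?_⟩
    rw [mul_pow]
    linear_combination (M.adjugate j l₀ ^ q * M.det ^ q * (r ᵥ* M.adjugate) l₀ ^ q) * hxy

end Linkage

section GenericMatrix

open Matrix

theorem Matrix.det_mem_subring {S n : Type*} [CommRing S] [Fintype n] [DecidableEq n]
    (B : Subring S) {M : Matrix n n S} (h : ∀ i j, M i j ∈ B) : M.det ∈ B := by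
  rw [det_apply]
  exact sum_mem fun σ _ => zsmul_mem (prod_mem fun i _ => h _ _) _

theorem Matrix.vecMul_adjugate_apply {S n : Type*} [CommRing S] [Fintype n] [DecidableEq n]
    (M : Matrix n n S) (r : n → S) (l : n) :
    (r ᵥ* M.adjugate) l = (M.updateRow l r).det := by
  rw [← cramer_transpose_apply, cramer_eq_adjugate_mulVec, ← adjugate_transpose, mulVec_transpose]

theorem Matrix.vecMul_adjugate_eq_sign_mul_det {S : Type*} [CommRing S] {m : ℕ}
    (x : Fin (m + 2) → Fin (m + 1) → S) (l : Fin (m + 1)) :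
    (x 0 ᵥ* (of fun i : Fin (m + 1) => x i.succ).adjugate) l =
      (Equiv.Perm.sign l.cycleRange : ℤ) *
        (of fun i : Fin (m + 1) => x (l.succ.succAbove i)).det := by
  rw [vecMul_adjugate_apply, ← det_permute]
  congr 1
  ext i j
  simp only [submatrix_apply, id_eq, of_apply, Fin.succAbove_cycleRange]
  by_cases h : i = l
  · subst h
    rw [updateRow_self, Equiv.swap_apply_right]
  · rw [updateRow_ne h, Equiv.swap_apply_of_ne_of_ne (Fin.succ_ne_zero i)
      (fun h' => h (Fin.succ_injective _ h'))]
    rfl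

/-- The lower square part of the matrix `x`. -/
abbrev lowerSquare {S : Type*} {m : ℕ} (x : Fin (m + 2) × Fin (m + 1) → S) :
    Matrix (Fin (m + 1)) (Fin (m + 1)) S :=
  of fun i j => x (i.succ, j)

/-- The first row of the matrix `x`. -/
abbrev topRow {S : Type*} {m : ℕ} (x : Fin (m + 2) × Fin (m + 1) → S) : Fin (m + 1) → S :=
  fun j => x (0, j)

theorem lowerSquare_adjugate_mem_subring {S : Type*} [CommRing S] {m : ℕ}
    {x : Fin (m + 2) × Fin (m + 1) → S} (B : Subring S) (j l : Fin (m + 1))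
    (h : ∀ i c, i ≠ l → c ≠ j → x (i.succ, c) ∈ B) : (lowerSquare x).adjugate j l ∈ B := by
  cases m with
  | zero => 
    rw [adjugate_fin_succ_eq_det_submatrix]
    exact B.mul_mem (B.pow_mem (B.neg_mem B.one_mem) _) (det_mem_subring B fun i => i.elim0)
  | succ m =>
    rw [adjugate_fin_succ_eq_det_submatrix]
    exact B.mul_mem (B.pow_mem (B.neg_mem B.one_mem) _) (det_mem_subring B fun i c =>
      h _ _ (Fin.succAbove_ne _ _) (Fin.succAbove_ne _ _))

end GenericMatrix

namespace MvPolynomial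

variable {σ k : Type*} [Field k]

theorem notMem_vars_of_dvd {f P : MvPolynomial σ k} {v : σ} (h : f ∣ P) (hP : P ≠ 0)
    (hv : v ∉ P.vars) : v ∉ f.vars := by
  classical
  obtain ⟨g, rfl⟩ := h
  have hf := left_ne_zero_of_mul hP
  have hg := right_ne_zero_of_mul hP
  rw [mem_vars_iff_degreeOf_ne_zero, not_not] at hv ⊢
  rw [degreeOf_mul_eq hf hg] at hv
  lia

end MvPolynomial

section RelPrime

open Matrix MvPolynomial

variable {k : Type*} [Field k] {m : ℕ}

theorem map_det_lowerSquare {S T : Type*} [CommRing S] [CommRing T] (φ : S →+* T)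
    (x : Fin (m + 2) × Fin (m + 1) → S) :
    φ (lowerSquare x).det = (lowerSquare (φ ∘ x)).det :=
  φ.map_det _

theorem map_adjugate_lowerSquare {S T : Type*} [CommRing S] [CommRing T] (φ : S →+* T)
    (x : Fin (m + 2) × Fin (m + 1) → S) (j l : Fin (m + 1)) :
    φ ((lowerSquare x).adjugate j l) = (lowerSquare (φ ∘ x)).adjugate j l :=
  congrFun (congrFun (φ.map_adjugate (lowerSquare x)) j) l

theorem map_vecMul_adjugate_lowerSquare {S T : Type*} [CommRing S] [CommRing T] (φ : S →+* T)
    (x : Fin (m + 2) × Fin (m + 1) → S) (l : Fin (m + 1)) :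
    φ ((topRow x ᵥ* (lowerSquare x).adjugate) l) =
      (topRow (φ ∘ x) ᵥ* (lowerSquare (φ ∘ x)).adjugate) l := by
  simp only [vecMul, dotProduct, map_sum, map_mul, map_adjugate_lowerSquare]
  rfl

theorem det_lowerSquare_X_ne_zero :
    (lowerSquare (X : Fin (m + 2) × Fin (m + 1) → MvPolynomial _ k)).det ≠ 0 := by
  intro h
  have := congrArg (eval fun v : Fin (m + 2) × Fin (m + 1) =>
    if v.1 = v.2.succ then (1 : k) else 0) h
  rw [map_det_lowerSquare, map_zero] at this
  have h1 : lowerSquare ((eval fun v : Fin (m + 2) × Fin (m + 1) =>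
      if v.1 = v.2.succ then (1 : k) else 0) ∘ X) = 1 := by
    ext i j
    simp [Matrix.one_apply]
  rw [h1, det_one] at this
  exact one_ne_zero this

theorem adjugate_lowerSquare_X_ne_zero (j l : Fin (m + 1)) :
    (lowerSquare (X : Fin (m + 2) × Fin (m + 1) → MvPolynomial _ k)).adjugate j l ≠ 0 := by
  intro h
  let y : Fin (m + 2) × Fin (m + 1) → k := fun v =>
    Fin.cases 0 (fun i => (Equiv.swap j l).permMatrix k i v.2) v.1
  have := congrArg (eval y) h
  rw [map_adjugate_lowerSquare, map_zero] at this
  have h1 : lowerSquare (eval y ∘ X) = (Equiv.swap j l).permMatrix k := by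
    ext i j
    simp [y]
  rw [h1, adjugate_apply] at this
  have h2 : ((Equiv.swap j l).permMatrix k).updateRow l (Pi.single j 1) =
      (Equiv.swap j l).permMatrix k := by
    ext a c
    by_cases ha : a = l
    · subst ha
      simp [Equiv.Perm.permMatrix, PEquiv.toMatrix_apply, Pi.single_apply, eq_comm]
    · rw [updateRow_ne ha]
  rw [h2, det_permutation, Equiv.Perm.sign_swap'] at this
  split_ifs at this <;> simp at this

theorem isRelPrime_det_vecMul_adjugate (l : Fin (m + 1)) :
    IsRelPrime (lowerSquare (X : Fin (m + 2) × Fin (m + 1) → MvPolynomial _ k)).det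
      ((topRow X ᵥ* (lowerSquare (X : Fin (m + 2) × Fin (m + 1) →
        MvPolynomial _ k)).adjugate) l) := by
  intro f hD hE
  have htop : ∀ c, (0, c) ∉ f.vars := by
    intro c
    refine notMem_vars_of_dvd hD det_lowerSquare_X_ne_zero fun hc => ?_
    have : (lowerSquare (X : Fin (m + 2) × Fin (m + 1) → MvPolynomial _ k)).det ∈
        (supported k {v : Fin (m + 2) × Fin (m + 1) | v.1 ≠ 0}).toSubring :=
      det_mem_subring _ fun i j => X_mem_supported.2 (Fin.succ_ne_zero i)
    exact (mem_supported.1 this hc) rfl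
  have hadj : ∀ i, f ∣ (lowerSquare (X : Fin (m + 2) × Fin (m + 1) →
      MvPolynomial _ k)).adjugate i l := by
    intro i
    let φ : MvPolynomial (Fin (m + 2) × Fin (m + 1)) k →ₐ[k] MvPolynomial _ k :=
      aeval fun v => if v.1 = 0 then (if v.2 = i then 1 else 0) else X v
    have hf : φ f = f := by
      refine hom_congr_vars (f₁ := φ.toRingHom) (f₂ := RingHom.id _) ?_ ?_ rfl
      · ext; simp [φ]
      · intro v hv _
        have : v.1 ≠ 0 := fun h => htop v.2 (by rwa [← h])
        simp [φ, this]
    have h1 := map_dvd φ.toRingHom hE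
    rw [map_vecMul_adjugate_lowerSquare] at h1
    have h2 : lowerSquare (φ.toRingHom ∘ X) =
        lowerSquare X := by
      ext a c
      simp [φ]
    have h3 : topRow (φ.toRingHom ∘ X) =
        Pi.single i 1 := by
      ext c
      simp [φ, Pi.single_apply]
    rw [h2, h3, single_one_vecMul] at h1
    simpa [hf] using h1
  have hvars : f.vars = ∅ := by
    refine Finset.eq_empty_of_forall_notMem fun v hv => ?_
    refine notMem_vars_of_dvd (hadj v.2) (adjugate_lowerSquare_X_ne_zero _ _) (fun hc => ?_) hv
    have : (lowerSquare (X : Fin (m + 2) × Fin (m + 1) → MvPolynomial _ k)).adjugate v.2 l ∈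
        (supported k {w : Fin (m + 2) × Fin (m + 1) | w.2 ≠ v.2}).toSubring :=
      lowerSquare_adjugate_mem_subring _ _ _ fun i c _ hc => X_mem_supported.2 hc
    exact (mem_supported.1 this hc) rfl
  rw [vars_eq_empty_iff_eq_C] at hvars
  have hf : f ≠ 0 := ne_zero_of_dvd_ne_zero det_lowerSquare_X_ne_zero hD
  rw [hvars] at hf ⊢
  exact (isUnit_iff_ne_zero.2 fun h => hf (by rw [h, C_0])).map C

theorem pow_mul_mem_map_iterateFrobenius_lowerSquare (p e : ℕ) [ExpChar k p]
    (l : Fin (m + 1)) {z : MvPolynomial (Fin (m + 2) × Fin (m + 1)) k}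
    (hz : z ∈ borderIdeal (lowerSquare X) (topRow X)) :
    ((lowerSquare X).det * (topRow X ᵥ* (lowerSquare X).adjugate) l) ^ (p ^ e - 1) * z ∈
      (borderIdeal (lowerSquare X) (topRow X)).map (iterateFrobenius _ p e) :=
  pow_mul_mem_map_iterateFrobenius p e _ _ l det_lowerSquare_X_ne_zero
    (fun _ => (isRelPrime_det_vecMul_adjugate l).pow.dvd_of_dvd_mul_left) hz

end RelPrime

section Coefficient

open Matrix MvPolynomial

variable {k : Type*} [Field k]

/-- The algebra endomorphism of a polynomial ring which sets to zero the variables outside `T`. -/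
noncomputable def restrictVars {σ : Type*} (k : Type*) [Field k] (T : σ → Prop) [DecidablePred T] :
    MvPolynomial σ k →ₐ[k] MvPolynomial σ k :=
  aeval fun v => if T v then X v else 0

theorem restrictVars_X {σ : Type*} (T : σ → Prop) [DecidablePred T] (v : σ) :
    restrictVars k T (X v) = if T v then X v else 0 :=
  aeval_X _ _

theorem coeff_restrictVars {σ : Type*} {T : σ → Prop} [DecidablePred T] {μ : σ →₀ ℕ}
    (hμ : ∀ v, ¬ T v → μ v = 0) (P : MvPolynomial σ k) :
    coeff μ (restrictVars k T P) = coeff μ P := by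
  classical
  induction P using MvPolynomial.induction_on' with
  | add P Q hP hQ => simp [hP, hQ]
  | monomial α c =>
    rw [restrictVars, aeval_monomial]
    by_cases h : ∀ v, ¬ T v → α v = 0
    · rw [monomial_eq]
      congr 2
      refine Finsupp.prod_congr fun v hv => ?_
      rw [if_pos (by_contra fun hT => Finsupp.mem_support_iff.1 hv (h v hT))]
    · push Not at h
      obtain ⟨v, hT, hv⟩ := h
      have : (α.prod fun i n => (if T i then X i else 0 : MvPolynomial σ k) ^ n) = 0 :=
        Finset.prod_eq_zero (Finsupp.mem_support_iff.2 hv) (by simp only [if_neg hT, zero_pow hv])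
      rw [this, mul_zero, coeff_zero, coeff_monomial, if_neg]
      rintro rfl
      exact hv (hμ v hT)

theorem prod_X_eq_monomial {σ ι : Type*} [Fintype ι] (f : ι → σ) :
    ∏ i, (X (f i) : MvPolynomial σ k) = monomial (∑ i, Finsupp.single (f i) 1) 1 := by
  rw [monomial_sum_one]
  rfl

theorem sum_single_apply_eq_zero {σ ι : Type*} [Fintype ι] {f : ι → σ} {v : σ}
    (h : ∀ i, f i ≠ v) : (∑ i, Finsupp.single (f i) 1 : σ →₀ ℕ) v = 0 := by
  rw [Finsupp.finsetSum_apply]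
  exact Finset.sum_eq_zero fun i _ => Finsupp.single_eq_of_ne (h i).symm

theorem sum_single_apply_le_one {σ ι : Type*} [Fintype ι] {f : ι → σ}
    (hf : Function.Injective f) (v : σ) : (∑ i, Finsupp.single (f i) 1 : σ →₀ ℕ) v ≤ 1 := by
  by_cases h : ∃ i, f i = v
  · obtain ⟨i, rfl⟩ := h
    rw [Finsupp.finsetSum_apply, Finset.sum_eq_single i, Finsupp.single_eq_same]
    · exact fun j _ hj => Finsupp.single_eq_of_ne fun h => hj (hf h).symm
    · exact fun h => absurd (Finset.mem_univ i) h
  · exact (sum_single_apply_eq_zero fun i hi => h ⟨i, hi⟩).trans_le zero_le_one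

variable {m : ℕ}

/-- The exponent of the product of the entries of the generic matrix on the three diagonals. -/
noncomputable def diagExp (m N : ℕ) : Fin (m + 2) × Fin (m + 1) →₀ ℕ :=
  N • ∑ i : Fin (m + 1), Finsupp.single (i.succ, i) 1 +
    (N • ∑ i : Fin (m + 1), Finsupp.single (i.castSucc, i) 1 +
      ∑ i : Fin m, Finsupp.single (i.succ.succ, i.castSucc) 1)

theorem coeff_diagExp_pow_mul (N : ℕ) :
    coeff (diagExp m N)
      ((of fun i j : Fin (m + 1) => (X (i.succ, j) : MvPolynomial (Fin (m + 2) × Fin (m + 1)) k)).det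
          ^ N *
        ((of fun i j : Fin (m + 1) => X (i.castSucc, j)).det ^ N *
          (of fun i j : Fin m => X (i.succ.succ, j.castSucc)).det)) = 1 := by
  let T : Fin (m + 2) × Fin (m + 1) → Prop := fun v => (v.2 : ℕ) ≤ v.1 ∧ (v.1 : ℕ) ≤ v.2 + 2
  let T' : Fin (m + 2) × Fin (m + 1) → Prop := fun v => v.1 = v.2.succ
  rw [← coeff_restrictVars (T := T), map_mul, map_mul, map_pow, map_pow]
  · have hG : restrictVars k T (of fun i j : Fin (m + 1) => X (i.castSucc, j)).det =
        monomial (∑ i : Fin (m + 1), Finsupp.single (i.castSucc, i) 1) 1 := by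
      rw [AlgHom.map_det, det_of_isLowerTriangular, ← prod_X_eq_monomial]
      · refine Finset.prod_congr rfl fun i _ => ?_
        simp [restrictVars_X, T]
      · intro i j hij
        have hij : i < j := hij
        simp [restrictVars_X, T, hij]
    have hw : restrictVars k T (of fun i j : Fin m => X (i.succ.succ, j.castSucc)).det =
        monomial (∑ i : Fin m, Finsupp.single (i.succ.succ, i.castSucc) 1) 1 := by
      rw [AlgHom.map_det, det_of_isUpperTriangular, ← prod_X_eq_monomial]
      · refine Finset.prod_congr rfl fun i _ => ?_
        simp [restrictVars_X, T]
        lia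
      · intro i j hij
        have hij : j < i := hij
        simp [restrictVars_X, T, hij]
    have hD : restrictVars k T' (restrictVars k T (of fun i j : Fin (m + 1) => X (i.succ, j)).det) =
        monomial (∑ i : Fin (m + 1), Finsupp.single (i.succ, i) 1) 1 := by
      rw [AlgHom.map_det, AlgHom.map_det, ← prod_X_eq_monomial, ← det_diagonal]
      congr 1
      ext1 i j
      by_cases h : i = j
      · subst h
        simp [restrictVars_X, T, T']
      · simp [restrictVars_X, T, T', h, apply_ite]
    rw [hG, hw, monomial_pow, monomial_mul, diagExp, coeff_mul_monomial,
      ← coeff_restrictVars (T := T'), map_pow, hD, monomial_pow, coeff_monomial, if_pos rfl]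
    · simp
    · intro v hv
      rw [Finsupp.smul_apply, sum_single_apply_eq_zero, smul_zero]
      rintro i rfl
      exact hv rfl
  · intro v hv
    rw [diagExp, Finsupp.add_apply, Finsupp.add_apply, Finsupp.smul_apply, Finsupp.smul_apply,
      sum_single_apply_eq_zero, sum_single_apply_eq_zero, sum_single_apply_eq_zero, smul_zero,
      add_zero, add_zero]
    all_goals
      rintro i rfl
      exact hv ⟨by simp [add_assoc], by simp⟩

theorem diagExp_le {N : ℕ} (hN : 0 < N) (v : Fin (m + 2) × Fin (m + 1)) :
    diagExp m N v ≤ N := by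
  obtain ⟨a, c⟩ := v
  have h1 := sum_single_apply_le_one (f := fun i : Fin (m + 1) => (i.succ, i))
    (fun i j h => congrArg Prod.snd h) (a, c)
  have h2 := sum_single_apply_le_one (f := fun i : Fin (m + 1) => (i.castSucc, i))
    (fun i j h => congrArg Prod.snd h) (a, c)
  have h3 := sum_single_apply_le_one (f := fun i : Fin m => (i.succ.succ, i.castSucc))
    (fun i j h => Fin.castSucc_injective _ (congrArg Prod.snd h)) (a, c)
  have h1' := sum_single_apply_eq_zero (f := fun i : Fin (m + 1) => (i.succ, i)) (v := (a, c))
  have h2' := sum_single_apply_eq_zero (f := fun i : Fin (m + 1) => (i.castSucc, i)) (v := (a, c))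
  have h3' := sum_single_apply_eq_zero (f := fun i : Fin m => (i.succ.succ, i.castSucc))
    (v := (a, c))
  simp only [ne_eq, Prod.mk.injEq, Fin.ext_iff, Fin.val_succ, Fin.val_castSucc, not_and]
    at h1' h2' h3'
  rw [diagExp, Finsupp.add_apply, Finsupp.add_apply, Finsupp.smul_apply, Finsupp.smul_apply,
    smul_eq_mul, smul_eq_mul]
  rcases eq_or_ne (a : ℕ) (c + 1) with h | h
  · rw [h2' (by lia), h3' (by lia)]
    nlinarith
  · rw [h1' (by lia)]
    rcases eq_or_ne (a : ℕ) c with h | h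
    · rw [h3' (by lia)]
      nlinarith
    · rw [h2' (by lia)]
      lia

theorem coeff_diagExp_ne_zero (N : ℕ) :
    coeff (diagExp m N)
      (((lowerSquare X).det * (topRow X ᵥ* (lowerSquare X).adjugate) (Fin.last m)) ^ N *
        (lowerSquare (X : Fin (m + 2) × Fin (m + 1) → MvPolynomial _ k)).adjugate
          (Fin.last m) 0) ≠ 0 := by
  have hE : (topRow X ᵥ* (lowerSquare X).adjugate) (Fin.last m) =
      C ((Equiv.Perm.sign (Fin.last m).cycleRange : ℤ) : k) * (of fun i j : Fin (m + 1) =>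
        (X (i.castSucc, j) : MvPolynomial (Fin (m + 2) × Fin (m + 1)) k)).det := by
    have := vecMul_adjugate_eq_sign_mul_det (fun i j =>
      (X (i, j) : MvPolynomial (Fin (m + 2) × Fin (m + 1)) k)) (Fin.last m)
    simpa using this
  have hw : (lowerSquare (X : Fin (m + 2) × Fin (m + 1) → MvPolynomial _ k)).adjugate
      (Fin.last m) 0 = C ((-1) ^ m) * (of fun i j : Fin m =>
        (X (i.succ.succ, j.castSucc) : MvPolynomial (Fin (m + 2) × Fin (m + 1)) k)).det := by
    rw [adjugate_fin_succ_eq_det_submatrix]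
    congr 1
    · simp
    · congr 1
      ext1 i j
      simp
  rw [hE, hw]
  have h (a b : k) (P Q W : MvPolynomial (Fin (m + 2) × Fin (m + 1)) k) :
      (P * (C a * Q)) ^ N * (C b * W) = C (a ^ N * b) * (P ^ N * (Q ^ N * W)) := by
    rw [C_mul, C_pow]
    ring
  rw [h, coeff_C_mul, coeff_diagExp_pow_mul, mul_one]
  refine mul_ne_zero (pow_ne_zero _ ?_) (pow_ne_zero _ (neg_ne_zero.2 one_ne_zero))
  simp

end Coefficient

theorem IsRootLinear.exists_quotient {R : Type*} [CommRing R] {q : ℕ} {θ : R →+ R}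
    (hθ : IsRootLinear q θ) {I : Ideal R} (hI : ∀ x ∈ I, θ x ∈ I) :
    ∃ ψ : R ⧸ I →+ R ⧸ I, IsRootLinear q ψ ∧
      ∀ x, ψ (Ideal.Quotient.mk I x) = Ideal.Quotient.mk I (θ x) := by
  refine ⟨QuotientAddGroup.map I.toAddSubgroup I.toAddSubgroup θ hI, ?_, fun x => rfl⟩
  intro a x
  obtain ⟨a, rfl⟩ := Ideal.Quotient.mk_surjective a
  obtain ⟨x, rfl⟩ := Ideal.Quotient.mk_surjective x
  rw [← map_pow, ← map_mul]
  change Ideal.Quotient.mk I (θ (a ^ q * x)) = Ideal.Quotient.mk I a * Ideal.Quotient.mk I (θ x)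
  rw [hθ, map_mul]

theorem IsRootLinear.mem_of_mem_map_iterateFrobenius {R : Type*} [CommRing R] {p e : ℕ}
    [ExpChar R p] {θ : R →+ R} (hθ : IsRootLinear (p ^ e) θ) {I : Ideal R} {x : R}
    (hx : x ∈ I.map (iterateFrobenius R p e)) : θ x ∈ I := by
  suffices ∀ c, θ (c * x) ∈ I by simpa using this 1
  refine Submodule.span_induction ?_ ?_ ?_ ?_ hx
  · rintro _ ⟨y, hy, rfl⟩ c
    rw [iterateFrobenius_def, mul_comm, hθ]
    exact I.mul_mem_right _ hy
  · simp
  · intro x y _ _ hx hy c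
    rw [mul_add, map_add]
    exact I.add_mem (hx c) (hy c)
  · intro a x _ hx c
    rw [smul_eq_mul, ← mul_assoc]
    exact hx _

namespace MvPowerSeries

section Duality

/-- The exponent whose entries are all equal to `N`. -/
noncomputable def constExp (σ : Type*) [Finite σ] (N : ℕ) : σ →₀ ℕ :=
  Finsupp.equivFunOnFinite.symm fun _ => N

@[simp]
theorem constExp_apply {σ : Type*} [Finite σ] (N : ℕ) (s : σ) : constExp σ N s = N := rfl

theorem isRootLinear_rootCoeff_constExp {σ k : Type*} [Field k] [Finite σ] (p e : ℕ)
    [ExpChar k p] [PerfectRing k p] :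
    IsRootLinear (p ^ e) (rootCoeff (k := k) p e (constExp σ (p ^ e - 1))) :=
  isRootLinear_rootCoeff p e fun s => by
    have : 0 < p ^ e := Nat.pos_of_ne_zero (pow_ne_zero _ (expChar_ne_zero k p))
    rw [constExp_apply]
    omega

variable {σ k : Type*} [Field k] [Fintype σ] [DecidableEq σ] {v w : σ} {g a b : MvPowerSeries σ k}

theorem exists_mem_freeOf_sub_mem (hvw : v ≠ w) (hg : g ∈ freeOf k v ⊓ freeOf k w)
    (ha : a ∈ freeOf k v ⊓ freeOf k w) (hb : b ∈ freeOf k v ⊓ freeOf k w)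
    {I : Ideal (MvPowerSeries σ k)} (hIa : X v * g + a ∈ I) (hIb : X w * g + b ∈ I)
    {q : ℕ} (β : σ → Fin q) :
    ∃ f ∈ freeOf k v ⊓ freeOf k w, g ^ (2 * q) * monomial (boxExp β) 1 - f ∈ I := by
  set β' : σ →₀ ℕ := ((boxExp β).erase v).erase w with hβ'
  have hβ : boxExp β = Finsupp.single v (β v : ℕ) + Finsupp.single w (β w : ℕ) + β' := by
    ext s
    by_cases hv : s = v
    · subst hv
      simp [hβ', hvw]
    · by_cases hw : s = w
      · subst hw
        simp [hβ', hvw.symm]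
      · simp [hβ', hv, hw]
  have hm : monomial β' 1 ∈ freeOf k v ⊓ freeOf k w :=
    ⟨monomial_mem_freeOf (by simp [hβ', hvw]) 1, monomial_mem_freeOf (by simp [hβ']) 1⟩
  refine ⟨g ^ (q - β v) * (-a) ^ (β v : ℕ) * (g ^ (q - β w) * (-b) ^ (β w : ℕ)) *
    monomial β' 1, mul_mem (mul_mem (mul_mem (pow_mem hg _) (pow_mem (neg_mem ha) _))
      (mul_mem (pow_mem hg _) (pow_mem (neg_mem hb) _))) hm, ?_⟩
  have h1 : Ideal.Quotient.mk I (-a) = Ideal.Quotient.mk I (X v * g) := by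
    rw [eq_comm, Ideal.Quotient.eq, sub_neg_eq_add]
    exact hIa
  have h2 : Ideal.Quotient.mk I (-b) = Ideal.Quotient.mk I (X w * g) := by
    rw [eq_comm, Ideal.Quotient.eq, sub_neg_eq_add]
    exact hIb
  have h3 : g ^ (2 * q) * monomial (boxExp β) 1 =
      g ^ (q - β v) * (X v * g) ^ (β v : ℕ) * (g ^ (q - β w) * (X w * g) ^ (β w : ℕ)) *
        monomial β' 1 := by
    rw [hβ, ← one_mul (1 : k), ← monomial_mul_monomial, ← one_mul (1 : k),
      ← monomial_mul_monomial, ← X_pow_eq, ← X_pow_eq, one_mul, two_mul]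
    have h (i : ℕ) (hi : i < q) (y : MvPowerSeries σ k) :
        g ^ (q - i) * (y * g) ^ i = g ^ q * y ^ i := by
      rw [mul_pow, mul_left_comm, ← pow_add, Nat.sub_add_cancel hi.le, mul_comm]
    rw [h _ (β v).2, h _ (β w).2, pow_add, one_mul]
    ring
  rw [← Ideal.Quotient.eq, h3]
  simp only [map_mul, map_pow, h1, h2]

variable (p e : ℕ) [ExpChar k p] [PerfectRing k p]

theorem rootCoeff_constExp_monomial {τ : σ →₀ ℕ} (hτ : ∀ s, τ s + 1 < 2 * p ^ e) :
    rootCoeff p e (constExp σ (p ^ e - 1)) (monomial τ (1 : k)) =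
      if τ = constExp σ (p ^ e - 1) then 1 else 0 := by
  have hq : 0 < p ^ e := Nat.pos_of_ne_zero (pow_ne_zero _ (expChar_ne_zero k p))
  ext α
  rw [coeff_rootCoeff, coeff_monomial]
  by_cases hα : α = 0
  · subst hα
    rw [smul_zero, zero_add]
    by_cases h : τ = constExp σ (p ^ e - 1)
    · simp [h]
    · simp [h, Ne.symm h]
  · rw [if_neg, map_zero]
    · split_ifs <;> simp [coeff_one, hα]
    · obtain ⟨s, hs⟩ := Finsupp.ne_iff.1 hα
      intro h
      have h1 := DFunLike.congr_fun h s
      have h2 := hτ s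
      simp only [Finsupp.coe_add, Finsupp.coe_smul, Pi.add_apply, Pi.smul_apply,
        smul_eq_mul, constExp_apply] at h1
      have h3 : p ^ e * 1 ≤ p ^ e * α s := Nat.mul_le_mul_left _ (Nat.pos_of_ne_zero hs)
      omega

/-- The exponent complementary to `γ` away from `v` and `w`. -/
noncomputable def complExp {q : ℕ} (v w : σ) (γ : σ → Fin q) : σ →₀ ℕ :=
  Finsupp.equivFunOnFinite.symm fun s => if s = v ∨ s = w then 0 else q - 1 - γ s

theorem complExp_apply {q : ℕ} (v w : σ) (γ : σ → Fin q) (s : σ) :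
    complExp v w γ s = if s = v ∨ s = w then 0 else q - 1 - (γ s : ℕ) := rfl

theorem rootCoeff_constExp_linear_mul (hvw : v ≠ w) (hg : g ∈ freeOf k v ⊓ freeOf k w)
    (ha : a ∈ freeOf k v ⊓ freeOf k w) (hb : b ∈ freeOf k v ⊓ freeOf k w)
    {β γ : σ → Fin (p ^ e)} (hβv : (β v : ℕ) = 0) (hβw : (β w : ℕ) = 0) (hγv : (γ v : ℕ) = 0)
    (hγw : (γ w : ℕ) = 0) :
    rootCoeff p e (constExp σ (p ^ e - 1))
      (((X v * g + a) * (X w * g + b)) ^ (p ^ e - 1) *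
        (g ^ 2 * monomial (complExp v w γ) 1 * monomial (boxExp β) 1)) =
      if β = γ then g ^ 2 else 0 := by
  have hq : 0 < p ^ e := Nat.pos_of_ne_zero (pow_ne_zero _ (expChar_ne_zero k p))
  set N := p ^ e - 1 with hN
  set τ : σ →₀ ℕ := Finsupp.single v N + Finsupp.single w N + (complExp v w γ + boxExp β) with hτ
  have hm : ∀ u, (u = v ∨ u = w) →
      monomial (complExp v w γ) 1 * monomial (boxExp β) 1 ∈ freeOf k u := by
    intro u hu
    refine mul_mem (monomial_mem_freeOf ?_ _) (monomial_mem_freeOf ?_ _)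
    · rw [complExp_apply, if_pos hu]
    · rw [boxExp_apply]
      rcases hu with rfl | rfl <;> assumption
  have hτs : ∀ s, τ s = if s = v ∨ s = w then N else N - γ s + β s := by
    intro s
    by_cases hv : s = v
    · subst hv
      simp [hτ, complExp_apply, hβv, hvw]
    · by_cases hw : s = w
      · subst hw
        simp [hτ, complExp_apply, hβw, hvw.symm]
      · simp [hτ, complExp_apply, hv, hw, ← hN]
  rw [mul_pow, mul_assoc, rootCoeff_linear_pow_mul p e hg.1 ha.1 _ (constExp_apply N v)]
  · have : (X v ^ N * (g ^ N * ((X w * g + b) ^ N *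
          (g ^ 2 * monomial (complExp v w γ) 1 * monomial (boxExp β) 1))) : MvPowerSeries σ k) =
        (X w * g + b) ^ N * (X v ^ N * (g ^ N * (g ^ 2 *
          (monomial (complExp v w γ) 1 * monomial (boxExp β) 1)))) := by ring
    rw [this, rootCoeff_linear_pow_mul p e hg.2 hb.2 _ (constExp_apply N w)]
    · have : (X w ^ N * (g ^ N * (X v ^ N * (g ^ N * (g ^ 2 *
            (monomial (complExp v w γ) 1 * monomial (boxExp β) 1))))) : MvPowerSeries σ k) =
          (g ^ 2) ^ p ^ e * monomial τ 1 := by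
        rw [hτ, ← one_mul (1 : k), ← monomial_mul_monomial, ← one_mul (1 : k),
          ← monomial_mul_monomial, ← monomial_mul_monomial, X_pow_eq, X_pow_eq]
        have : (g ^ 2) ^ p ^ e = g ^ N * g ^ N * g ^ 2 := by
          have h : p ^ e = N + 1 := by omega
          rw [h]
          ring
        rw [this]
        simp only [one_mul]
        ring
      rw [this, isRootLinear_rootCoeff_constExp, rootCoeff_constExp_monomial, mul_ite, mul_one,
        mul_zero, ← hN]
      · congr 1
        rw [eq_iff_iff, DFunLike.ext_iff, funext_iff]
        refine forall_congr' fun s => ?_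
        rw [hτs, constExp_apply, Fin.ext_iff]
        have := (γ s).2
        split_ifs with h
        · rcases h with rfl | rfl <;> simp [*]
        · omega
      · intro s
        rw [hτs]
        have := (β s).2
        have := (γ s).2
        split_ifs <;> omega
    · exact mul_mem (pow_mem (X_mem_freeOf hvw) _) (mul_mem (pow_mem hg.2 _)
        (mul_mem (pow_mem hg.2 _) (hm w (.inr rfl))))
  · refine mul_mem (pow_mem (add_mem (mul_mem (X_mem_freeOf hvw.symm) hg.1) hb.1) _) ?_
    rw [mul_assoc]
    exact mul_mem (pow_mem hg.1 _) (hm v (.inl rfl))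

theorem exists_sum_sub_mem (hvw : v ≠ w) (hg : g ∈ freeOf k v ⊓ freeOf k w)
    (ha : a ∈ freeOf k v ⊓ freeOf k w) (hb : b ∈ freeOf k v ⊓ freeOf k w)
    {I : Ideal (MvPowerSeries σ k)} (hIa : X v * g + a ∈ I) (hIb : X w * g + b ∈ I)
    (x : MvPowerSeries σ k) :
    ∃ c : (σ → Fin (p ^ e)) → MvPowerSeries σ k,
      (∀ γ, (γ v : ℕ) ≠ 0 ∨ (γ w : ℕ) ≠ 0 → c γ = 0) ∧
      g ^ (2 * p ^ e) * x - ∑ γ, c γ ^ p ^ e * monomial (boxExp γ) 1 ∈ I := by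
  choose f hf hfI using exists_mem_freeOf_sub_mem hvw hg ha hb hIa hIb (q := p ^ e)
  refine ⟨fun γ => ∑ β, rootCoeff p e (boxExp β) x * rootCoeff p e (boxExp γ) (f β), ?_, ?_⟩
  · intro γ hγ
    refine Finset.sum_eq_zero fun β _ => ?_
    rcases hγ with h | h
    · rw [rootCoeff_eq_zero_of_mem_freeOf p e (hf β).1 h, mul_zero]
    · rw [rootCoeff_eq_zero_of_mem_freeOf p e (hf β).2 h, mul_zero]
  · have : ExpChar (MvPowerSeries σ k) p := expChar_of_injective_ringHom C_injective p
    simp_rw [sum_pow_char_pow, Finset.sum_mul]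
    rw [Finset.sum_comm]
    simp_rw [mul_pow, mul_assoc, ← Finset.mul_sum, sum_rootCoeff_pow_mul_monomial]
    nth_rw 1 [← sum_rootCoeff_pow_mul_monomial p e x]
    rw [Finset.mul_sum, ← Finset.sum_sub_distrib]
    refine I.sum_mem fun β _ => ?_
    rw [mul_left_comm, ← mul_sub]
    exact I.mul_mem_left _ (hfI β)

theorem pow_mul_mem_span_rootIdeal (hvw : v ≠ w) (hg : g ∈ freeOf k v ⊓ freeOf k w)
    (ha : a ∈ freeOf k v ⊓ freeOf k w) (hb : b ∈ freeOf k v ⊓ freeOf k w)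
    {I : Ideal (MvPowerSeries σ k)} (hIa : X v * g + a ∈ I) (hIb : X w * g + b ∈ I)
    (hI : ∀ x ∈ I, rootCoeff p e (constExp σ (p ^ e - 1))
      (((X v * g + a) * (X w * g + b)) ^ (p ^ e - 1) * x) ∈ I) (d : MvPowerSeries σ k ⧸ I) :
    Ideal.Quotient.mk I g ^ (4 * p ^ e) * d ∈
      Ideal.span ((fun y => y ^ p ^ e) '' (rootIdeal (p ^ e) d : Set (MvPowerSeries σ k ⧸ I))) := by
  obtain ⟨x, rfl⟩ := Ideal.Quotient.mk_surjective d
  obtain ⟨c, hc, hcx⟩ := exists_sum_sub_mem p e hvw hg ha hb hIa hIb x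
  have hx : Ideal.Quotient.mk I (g ^ (2 * p ^ e) * x) = Ideal.Quotient.mk I
      (∑ γ, c γ ^ p ^ e * monomial (boxExp γ) 1) := Ideal.Quotient.eq.2 hcx
  have key : ∀ γ, Ideal.Quotient.mk I (c γ * g ^ 2) ∈
      rootIdeal (p ^ e) (Ideal.Quotient.mk I x) := by
    intro γ
    by_cases hγ : (γ v : ℕ) ≠ 0 ∨ (γ w : ℕ) ≠ 0
    · rw [hc γ hγ, zero_mul, map_zero]
      exact zero_mem _
    push Not at hγ
    let θ : MvPowerSeries σ k →+ MvPowerSeries σ k :=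
      (rootCoeff p e (constExp σ (p ^ e - 1))).comp (AddMonoidHom.mulLeft
        (((X v * g + a) * (X w * g + b)) ^ (p ^ e - 1) *
          (g ^ 2 * monomial (complExp v w γ) 1)))
    have hθ : IsRootLinear (p ^ e) θ := (isRootLinear_rootCoeff_constExp p e).comp_mulLeft _
    have hθx (x) : θ x = rootCoeff p e (constExp σ (p ^ e - 1))
        (((X v * g + a) * (X w * g + b)) ^ (p ^ e - 1) *
          (g ^ 2 * monomial (complExp v w γ) 1 * x)) :=
      congrArg (rootCoeff p e _) (mul_assoc _ _ _)
    have hθI : ∀ x ∈ I, θ x ∈ I := by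
      intro x hx
      rw [hθx]
      exact hI _ (I.mul_mem_left _ hx)
    obtain ⟨ψ, hψ, hψθ⟩ := hθ.exists_quotient hθI
    have h1 : ψ (Ideal.Quotient.mk I (g ^ (2 * p ^ e) * x)) =
        Ideal.Quotient.mk I (g ^ 2) * ψ (Ideal.Quotient.mk I x) := by
      rw [pow_mul, map_mul, map_pow, hψ]
    have h2 : θ (∑ γ, c γ ^ p ^ e * monomial (boxExp γ) 1) = c γ * g ^ 2 := by
      rw [map_sum, Finset.sum_eq_single γ]
      · rw [hθ, hθx, rootCoeff_constExp_linear_mul p e hvw hg ha hb hγ.1 hγ.2 hγ.1 hγ.2,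
          if_pos rfl]
      · intro β _ hβ
        by_cases hβ' : (β v : ℕ) ≠ 0 ∨ (β w : ℕ) ≠ 0
        · rw [hθ, hc β hβ', zero_mul]
        · push Not at hβ'
          rw [hθ, hθx, rootCoeff_constExp_linear_mul p e hvw hg ha hb hβ'.1 hβ'.2 hγ.1 hγ.2,
            if_neg hβ, mul_zero]
      · simp
    rw [← h2, ← hψθ, ← hx, h1]
    exact Ideal.mul_mem_left _ _ ⟨ψ, hψ, rfl⟩
  have h4 : Ideal.Quotient.mk I g ^ (4 * p ^ e) * Ideal.Quotient.mk I x =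
      ∑ γ, Ideal.Quotient.mk I (monomial (boxExp γ) 1) *
        Ideal.Quotient.mk I (c γ * g ^ 2) ^ p ^ e := by
    have : Ideal.Quotient.mk I g ^ (4 * p ^ e) * Ideal.Quotient.mk I x =
        Ideal.Quotient.mk I (g ^ (2 * p ^ e)) * Ideal.Quotient.mk I (g ^ (2 * p ^ e) * x) := by
      simp only [map_mul, map_pow]
      ring
    rw [this, hx, ← map_mul, Finset.mul_sum, map_sum]
    refine Finset.sum_congr rfl fun γ _ => ?_
    simp only [map_mul, map_pow]
    ring
  rw [h4]
  exact Ideal.sum_mem _ fun γ _ => Ideal.mul_mem_left _ _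
    (Ideal.subset_span ⟨_, key γ, rfl⟩)

end Duality

end MvPowerSeries

section GenericDeterminantal

open Matrix MvPowerSeries

variable {k : Type} [Field k] {m : ℕ}

theorem Imax_eq_borderIdeal :
    Imax k m = borderIdeal (lowerSquare X) (topRow X) := by
  have hE (l : Fin (m + 1)) := vecMul_adjugate_eq_sign_mul_det (fun i j =>
    (X (i, j) : MvPowerSeries (Fin (m + 2) × Fin (m + 1)) k)) l
  have hE' (l : Fin (m + 1)) :
      (topRow X ᵥ* (lowerSquare X).adjugate) l =
        ((Equiv.Perm.sign l.cycleRange : ℤ) : MvPowerSeries (Fin (m + 2) × Fin (m + 1)) k) *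
          Gmin k m l.succ := hE l
  have h0 : Gmin k m 0 = (lowerSquare X).det := by
    rw [Gmin]
    simp only [Fin.zero_succAbove]
  apply le_antisymm
  · rw [Imax, Ideal.span_le]
    rintro _ ⟨i, rfl⟩
    cases i using Fin.cases with
    | zero =>
      rw [h0]
      exact det_mem_borderIdeal _ _
    | succ l =>
      have : Gmin k m l.succ = ((Equiv.Perm.sign l.cycleRange : ℤ) :
          MvPowerSeries (Fin (m + 2) × Fin (m + 1)) k) *
            (topRow X ᵥ* (lowerSquare X).adjugate) l := by
        rw [hE', ← mul_assoc, ← Int.cast_mul, ← Units.val_mul, Int.units_mul_self,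
          Units.val_one, Int.cast_one, one_mul]
      rw [this]
      exact Ideal.mul_mem_left _ _ (vecMul_adjugate_mem_borderIdeal _ _ _)
  · rw [borderIdeal, Ideal.span_le]
    rintro _ (rfl | ⟨l, rfl⟩)
    · exact Ideal.subset_span ⟨0, h0⟩
    · rw [hE']
      exact Ideal.mul_mem_left _ _ (Ideal.subset_span ⟨_, rfl⟩)

theorem coe_comp_X {σ : Type*} :
    (MvPolynomial.coeToMvPowerSeries.ringHom (σ := σ) (R := k)) ∘ MvPolynomial.X = X :=
  funext fun v => MvPolynomial.coe_X v

theorem pow_mul_mem_map_iterateFrobenius_powerSeries (p e : ℕ) [ExpChar k p]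
    [ExpChar (MvPowerSeries (Fin (m + 2) × Fin (m + 1)) k) p] (l : Fin (m + 1))
    {x : MvPowerSeries (Fin (m + 2) × Fin (m + 1)) k} (hx : x ∈ Imax k m) :
    ((lowerSquare X).det * (topRow X ᵥ* (lowerSquare X).adjugate) l) ^ (p ^ e - 1) * x ∈
      (Imax k m).map (iterateFrobenius _ p e) := by
  let ρ := MvPolynomial.coeToMvPowerSeries.ringHom (σ := Fin (m + 2) × Fin (m + 1)) (R := k)
  have hρ : Imax k m = (borderIdeal (lowerSquare MvPolynomial.X)
      (topRow MvPolynomial.X)).map ρ := by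
    rw [Imax_eq_borderIdeal, ← borderIdeal_map, ← coe_comp_X]
    rfl
  have hx' := hx
  rw [hρ] at hx'
  refine Submodule.span_induction ?_ ?_ ?_ ?_ hx'
  · rintro _ ⟨z, hz, rfl⟩
    have h1 := Ideal.mem_map_of_mem ρ (pow_mul_mem_map_iterateFrobenius_lowerSquare p e l hz)
    rw [Ideal.map_map, RingHom.iterateFrobenius_comm, ← Ideal.map_map, ← hρ, map_mul, map_pow,
      map_mul, map_det_lowerSquare, map_vecMul_adjugate_lowerSquare, coe_comp_X] at h1
    exact h1
  · simp
  · intro x y _ _ hx hy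
    rw [mul_add]
    exact Ideal.add_mem _ hx hy
  · intro a x _ hx
    rw [smul_eq_mul, mul_left_comm]
    exact Ideal.mul_mem_left _ _ hx

variable (p e : ℕ) [ExpChar k p] [PerfectRing k p]

theorem rootCoeff_constExp_mem_Imax (l : Fin (m + 1))
    {x : MvPowerSeries (Fin (m + 2) × Fin (m + 1)) k} (hx : x ∈ Imax k m) :
    rootCoeff p e (constExp _ (p ^ e - 1))
      (((lowerSquare X).det * (topRow X ᵥ* (lowerSquare X).adjugate) l) ^ (p ^ e - 1) * x) ∈
        Imax k m := by
  have : ExpChar (MvPowerSeries (Fin (m + 2) × Fin (m + 1)) k) p :=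
    expChar_of_injective_ringHom C_injective p
  exact (isRootLinear_rootCoeff_constExp p e).mem_of_mem_map_iterateFrobenius
    (pow_mul_mem_map_iterateFrobenius_powerSeries p e l hx)

theorem exists_isRootLinear_adjugate_eq_one (hp : 1 < p) :
    ∃ ψ : MvPowerSeries (Fin (m + 2) × Fin (m + 1)) k ⧸ Imax k m →+ _ ⧸ Imax k m,
      IsRootLinear p ψ ∧
        ψ (Ideal.Quotient.mk _ ((lowerSquare X).adjugate (Fin.last m) 0)) = 1 := by
  classical
  set g : MvPowerSeries (Fin (m + 2) × Fin (m + 1)) k :=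
    (lowerSquare X).adjugate (Fin.last m) 0 with hg
  set F : MvPowerSeries (Fin (m + 2) × Fin (m + 1)) k := (lowerSquare X).det *
    (topRow X ᵥ* (lowerSquare X).adjugate) (Fin.last m) with hF
  set τ : Fin (m + 2) × Fin (m + 1) →₀ ℕ := constExp _ (p - 1) - diagExp m (p - 1) with hτ
  let θ := (rootCoeff (k := k) p 1 (constExp (Fin (m + 2) × Fin (m + 1)) (p ^ 1 - 1))).comp
    (AddMonoidHom.mulLeft (F ^ (p ^ 1 - 1) * monomial τ 1))
  have hθ : IsRootLinear (p ^ 1) θ := (isRootLinear_rootCoeff_constExp p 1).comp_mulLeft _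
  have hθI : ∀ x ∈ Imax k m, θ x ∈ Imax k m := by
    intro x hx
    have : θ x = rootCoeff p 1 (constExp _ (p ^ 1 - 1)) (F ^ (p ^ 1 - 1) * (monomial τ 1 * x)) :=
      congrArg (rootCoeff p 1 _) (mul_assoc _ _ _)
    rw [this]
    exact rootCoeff_constExp_mem_Imax p 1 _ (Ideal.mul_mem_left _ _ hx)
  have hτ' : τ + diagExp m (p - 1) = constExp _ (p - 1) :=
    tsub_add_cancel_of_le fun v => diagExp_le (Nat.sub_pos_of_lt hp) v
  have hunit : IsUnit (θ g) := by
    rw [isUnit_iff_constantCoeff, isUnit_iff_ne_zero, ← coeff_zero_eq_constantCoeff_apply]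
    have h1 : θ g = rootCoeff p 1 (constExp _ (p - 1)) (monomial τ 1 * (F ^ (p - 1) * g)) := by
      change rootCoeff p 1 _ (F ^ (p ^ 1 - 1) * monomial τ 1 * g) = _
      rw [pow_one, mul_assoc, mul_left_comm]
    let ρ := MvPolynomial.coeToMvPowerSeries.ringHom (σ := Fin (m + 2) × Fin (m + 1)) (R := k)
    have h2 : F ^ (p - 1) * g = ρ (((lowerSquare MvPolynomial.X).det *
        (topRow MvPolynomial.X ᵥ* (lowerSquare MvPolynomial.X).adjugate) (Fin.last m)) ^ (p - 1) *
          (lowerSquare MvPolynomial.X).adjugate (Fin.last m) 0) := by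
      rw [map_mul, map_pow, map_mul, map_det_lowerSquare, map_vecMul_adjugate_lowerSquare,
        map_adjugate_lowerSquare, coe_comp_X]
    rw [h1, coeff_rootCoeff, smul_zero, zero_add, ← hτ', coeff_add_monomial_mul, one_mul, h2,
      ne_eq, EmbeddingLike.map_eq_zero_iff]
    exact (MvPolynomial.coeff_coe _ _).trans_ne (coeff_diagExp_ne_zero (p - 1))
  obtain ⟨ψ, hψ, hψθ⟩ := hθ.exists_quotient hθI
  obtain ⟨u, hu⟩ := hunit
  rw [pow_one] at hψ
  refine ⟨_, hψ.mulLeft_comp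
    (Ideal.Quotient.mk _ (↑u⁻¹ : MvPowerSeries (Fin (m + 2) × Fin (m + 1)) k)), ?_⟩
  rw [AddMonoidHom.comp_apply, AddMonoidHom.coe_mulLeft, hψθ, ← hu, ← map_mul, Units.inv_mul,
    map_one]

theorem adjugate_mem_freeOf (j : Fin (m + 1))
    {v : Fin (m + 2) × Fin (m + 1)} (hv : v.1 = 0 ∨ v.1 = 1) :
    (lowerSquare X).adjugate j 0 ∈ freeOf k v :=
  lowerSquare_adjugate_mem_subring _ _ _ fun i c hi _ => X_mem_freeOf fun h => by
    have h1 : i.succ = v.1 := congrArg Prod.fst h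
    rcases hv with hv | hv
    · exact Fin.succ_ne_zero i (h1.trans hv)
    · exact hi (Fin.succ_injective _ (h1.trans hv))

theorem pow_mul_mem_span_rootIdeal_Imax
    (d : MvPowerSeries (Fin (m + 2) × Fin (m + 1)) k ⧸ Imax k m) :
    Ideal.Quotient.mk _ ((lowerSquare X).adjugate (Fin.last m) 0) ^ (4 * p ^ e) * d ∈
      Ideal.span ((fun y => y ^ p ^ e) '' (rootIdeal (p ^ e) d : Set (_ ⧸ Imax k m))) := by
  let s (r : Fin (m + 2)) : MvPowerSeries (Fin (m + 2) × Fin (m + 1)) k :=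
    ∑ j : Fin m, X (r, j.castSucc) * (lowerSquare X).adjugate j.castSucc 0
  have hs (r : Fin (m + 2)) {v : Fin (m + 2) × Fin (m + 1)} (hv : v.1 = 0 ∨ v.1 = 1)
      (hv' : v.2 = Fin.last m) : s r ∈ freeOf k v :=
    sum_mem fun j _ => mul_mem
      (X_mem_freeOf fun h => (Fin.castSucc_lt_last j).ne ((congrArg Prod.snd h).trans hv'))
      (adjugate_mem_freeOf _ hv)
  have hdet : (lowerSquare X).det = X ((0 : Fin (m + 1)).succ, Fin.last m) *
      (lowerSquare X).adjugate (Fin.last m) 0 + s (0 : Fin (m + 1)).succ := by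
    rw [det_eq_sum_mul_adjugate_row _ 0, Fin.sum_univ_castSucc]
    exact add_comm _ _
  have hE : (topRow X ᵥ* (lowerSquare X).adjugate) 0 = X (0, Fin.last m) *
      (lowerSquare X).adjugate (Fin.last m) 0 + s 0 := by
    rw [vecMul, dotProduct, Fin.sum_univ_castSucc]
    exact add_comm _ _
  refine pow_mul_mem_span_rootIdeal p e (v := ((0 : Fin (m + 1)).succ, Fin.last m))
    (w := (0, Fin.last m)) (a := s (0 : Fin (m + 1)).succ) (b := s 0) ?_
    ⟨adjugate_mem_freeOf _ (.inr rfl), adjugate_mem_freeOf _ (.inl rfl)⟩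
    ⟨hs _ (.inr rfl) rfl, hs _ (.inl rfl) rfl⟩ ⟨hs _ (.inr rfl) rfl, hs _ (.inl rfl) rfl⟩
    ?_ ?_ (fun x hx => ?_) d
  · exact fun h => Fin.succ_ne_zero (0 : Fin (m + 1)) (congrArg Prod.fst h)
  · rw [← hdet, Imax_eq_borderIdeal]
    exact det_mem_borderIdeal _ _
  · rw [← hE, Imax_eq_borderIdeal]
    exact vecMul_adjugate_mem_borderIdeal _ _ _
  · rw [← hdet, ← hE]
    exact rootCoeff_constExp_mem_Imax p e 0 hx

end GenericDeterminantal

/-- If `k` is a perfect field of characteristic `p ≥ 5` and `n ≥ 2` (here `n = m + 2`),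
then the generic determinantal ring `k[[X]]/I_{n-1}(X)` is strongly `F`-regular. -/
theorem stmt8 (p : ℕ) (hp : p.Prime) (hp5 : 5 ≤ p) (k : Type) [Field k] [CharP k p]
    (hperf : Function.Surjective fun x : k => x ^ p) (m : ℕ) :
    StronglyFRegular p (MvPowerSeries (Fin (m + 2) × Fin (m + 1)) k ⧸ Imax k m) := by
  have : ExpChar k p := ExpChar.prime hp
  have : PerfectRing k p := PerfectRing.ofSurjective k p hperf
  obtain ⟨ψ, hψ, hψg⟩ := exists_isRootLinear_adjugate_eq_one (k := k) (m := m) p hp.one_lt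
  refine stronglyFRegular_of_rootIdeal hp.one_lt _ 4
    (fun e => pow_mul_mem_span_rootIdeal_Imax p e) hψ hψg
end

section
/- One has the equality of ideals (I^{[p]} : I) ∩ (Ω^{[p]} : Ω) = I^{[p]} + ((G_3 G_2)^{p−1}) in R = k[[x, y, z, w, s, t]], where G_3 G_2 = (xs − yw)(xt − zw). -/
/- `R = k[[x, y, z, w, s, t]]`, with the six variables indexed by `Fin 6` in the order
`x, y, z, w, s, t`. -/
noncomputable def px (k : Type) [Field k] : MvPowerSeries (Fin 6) k := MvPowerSeries.X 0
noncomputable def py (k : Type) [Field k] : MvPowerSeries (Fin 6) k := MvPowerSeries.X 1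
noncomputable def pz (k : Type) [Field k] : MvPowerSeries (Fin 6) k := MvPowerSeries.X 2
noncomputable def pw (k : Type) [Field k] : MvPowerSeries (Fin 6) k := MvPowerSeries.X 3
noncomputable def ps (k : Type) [Field k] : MvPowerSeries (Fin 6) k := MvPowerSeries.X 4
noncomputable def pt (k : Type) [Field k] : MvPowerSeries (Fin 6) k := MvPowerSeries.X 5

/-- `G₁ = yt - zs`. -/
noncomputable def G1 (k : Type) [Field k] : MvPowerSeries (Fin 6) k := py k * pt k - pz k * ps k
/-- `G₂ = xt - zw`. -/
noncomputable def G2 (k : Type) [Field k] : MvPowerSeries (Fin 6) k := px k * pt k - pz k * pw k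
/-- `G₃ = xs - yw`. -/
noncomputable def G3 (k : Type) [Field k] : MvPowerSeries (Fin 6) k := px k * ps k - py k * pw k

/-- `I = I₂(X) = (G₁, G₂, G₃)`, the ideal of `2 × 2` minors of the `3 × 2` matrix `X` with
rows `(x, w), (y, s), (z, t)`. -/
noncomputable def I32 (k : Type) [Field k] : Ideal (MvPowerSeries (Fin 6) k) :=
  Ideal.span {G1 k, G2 k, G3 k}

/-- `P = (x, w)`. -/
noncomputable def P32 (k : Type) [Field k] : Ideal (MvPowerSeries (Fin 6) k) :=
  Ideal.span {px k, pw k}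

/-- `Ω = I + P`. -/
noncomputable def Om32 (k : Type) [Field k] : Ideal (MvPowerSeries (Fin 6) k) :=
  I32 k ⊔ P32 k

/-- `r` is a nonzerodivisor modulo the ideal generated by `s`. -/
def RegularMod {R : Type*} [CommRing R] (s : Set R) (r : R) : Prop :=
  ∀ c, r * c ∈ Ideal.span s → c ∈ Ideal.span s

namespace RegularMod

variable {R : Type*} [CommRing R] {s : Set R} {r r' u v : R}

theorem mul (h : RegularMod s r) (h' : RegularMod s r') : RegularMod s (r * r') :=
  fun c hc => h' c (h _ (by rwa [← mul_assoc]))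

theorem pow (h : RegularMod s r) (n : ℕ) : RegularMod s (r ^ n) := by
  induction n with
  | zero => intro c hc; simpa using hc
  | succ n ih => rw [pow_succ]; exact ih.mul h

theorem congr (h : RegularMod s r) (hr : r' - r ∈ Ideal.span s) : RegularMod s r' := by
  intro c hc
  refine h c ?_
  have := sub_mem hc (Ideal.mul_mem_right c _ hr)
  ring_nf at this
  rwa [mul_comm]

theorem neg (h : RegularMod s r) : RegularMod s (-r) := fun c hc => h c (by
  rw [neg_mul] at hc
  exact neg_mem_iff.1 hc)

/-- In a regular sequence the last two members may be exchanged, as far as the last one goes. -/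
theorem swap (hu : RegularMod s u) (hv : RegularMod (insert u s) v) :
    RegularMod (insert v s) u := by
  intro c hc
  obtain ⟨d, j, hj, e⟩ := Ideal.mem_span_insert.1 hc
  obtain ⟨d', j', hj', rfl⟩ := Ideal.mem_span_insert.1
    (hv d (Ideal.mem_span_insert.2 ⟨c, -j, neg_mem hj, by linear_combination -e⟩))
  refine Ideal.mem_span_insert.2 ⟨d', c - d' * v, hu _ ?_, by ring⟩
  have : u * (c - d' * v) = j + v * j' := by linear_combination e
  rw [this]
  exact add_mem hj (Ideal.mul_mem_left _ _ hj')

/-- By Nakayama's lemma, in a regular sequence in the Jacobson radical one may drop the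
penultimate member. -/
theorem of_insert [IsNoetherianRing R] (hj : u ∈ Ideal.jacobson (⊥ : Ideal R))
    (hu : RegularMod s u) (hv : RegularMod (insert u s) v) : RegularMod s v := by
  have hle : (Ideal.span s).colon {v} ≤ Ideal.span s := by
    refine Submodule.le_of_le_smul_of_le_jacobson_bot (I := Ideal.span {u})
      (IsNoetherian.noetherian _) ((Ideal.span_singleton_le_iff_mem _).2 hj) ?_
    intro c hc
    have hc : v * c ∈ Ideal.span s := by
      simpa [Submodule.mem_colon_singleton, mul_comm] using hc
    obtain ⟨d, j, hj, rfl⟩ := Ideal.mem_span_insert.1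
      (hv c (Ideal.span_mono (Set.subset_insert _ _) hc))
    rw [add_comm]
    refine Submodule.add_mem_sup hj ?_
    rw [mul_comm]
    refine Submodule.smul_mem_smul (Ideal.mem_span_singleton_self u) ?_
    rw [Submodule.mem_colon_singleton, smul_eq_mul, mul_comm]
    refine hu _ ?_
    have := sub_mem hc (Ideal.mul_mem_left _ v hj)
    ring_nf at this ⊢
    exact this
  intro c hc
  exact hle (by simpa [Submodule.mem_colon_singleton, mul_comm] using hc)

theorem insert_pow (hu : RegularMod s u) (hr : RegularMod (insert u s) r) (n : ℕ) :
    RegularMod (insert (u ^ n) s) r := by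
  induction n with
  | zero =>
    intro c _
    exact Ideal.mem_span_insert.2 ⟨c, 0, zero_mem _, by simp⟩
  | succ n ih =>
    intro c hc
    obtain ⟨d, j, hj, e⟩ := Ideal.mem_span_insert.1 hc
    obtain ⟨c', j', hj', rfl⟩ := Ideal.mem_span_insert.1
      (hr c (Ideal.mem_span_insert.2 ⟨d * u ^ n, j, hj, by linear_combination e⟩))
    have h1 : r * c' - d * u ^ n ∈ Ideal.span s := by
      refine hu _ ?_
      have : u * (r * c' - d * u ^ n) = j - r * j' := by linear_combination e
      rw [this]
      exact sub_mem hj (Ideal.mul_mem_left _ _ hj')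
    obtain ⟨b, i, hi, rfl⟩ := Ideal.mem_span_insert.1
      (ih c' (Ideal.mem_span_insert.2 ⟨d, _, h1, by ring⟩))
    exact Ideal.mem_span_insert.2 ⟨b, u * i + j',
      add_mem (Ideal.mul_mem_left _ _ hi) hj', by ring⟩

theorem of_ne_zero [IsDomain R] (hu : u ≠ 0) : RegularMod ∅ u := fun c hc => by
  simpa [hu] using hc

theorem singleton_pow [IsDomain R] (hu : u ≠ 0) (hr : RegularMod {u} r) (n : ℕ) :
    RegularMod {u ^ n} r := by
  rw [← insert_empty_eq] at hr ⊢
  exact (of_ne_zero hu).insert_pow hr n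

theorem pair_pow [IsDomain R] (hr : RegularMod {u, v} r) (hu : u ≠ 0)
    (huv : RegularMod {u} v) (hvu : RegularMod {v} u) (m n : ℕ) : RegularMod {u ^ m, v ^ n} r := by
  have h := hvu.insert_pow hr m
  rw [Set.pair_comm] at h ⊢
  exact (huv.singleton_pow hu m).insert_pow h n

/-- `(r ^ (n + 1), u ^ (n + 1), v ^ (n + 1)) : (r u v) ^ n ⊆ (r, u, v)` for a regular
sequence. -/
theorem mem_span_triple_of_mul_pow_mem {n : ℕ} (hu : RegularMod {v ^ (n + 1), r ^ (n + 1)} u)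
    (hv : RegularMod {u, r ^ (n + 1)} v) (hr : RegularMod {u, v} r) {c : R}
    (hc : c * (r * u * v) ^ n ∈ Ideal.span {r ^ (n + 1), u ^ (n + 1), v ^ (n + 1)}) :
    c ∈ Ideal.span {r, u, v} := by
  obtain ⟨a, b, d, e⟩ := Submodule.mem_span_triple.1 hc
  simp only [smul_eq_mul] at e
  obtain ⟨a₁, b₁, e₁⟩ := Ideal.mem_span_pair.1 (hu.pow n (c * r ^ n * v ^ n - b * u)
    (Ideal.mem_span_pair.2 ⟨d, a, by linear_combination e⟩))
  obtain ⟨a₂, b₂, e₂⟩ := Ideal.mem_span_pair.1 (hv.pow n (c * r ^ n - a₁ * v)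
    (Ideal.mem_span_pair.2 ⟨b, b₁, by linear_combination e₁⟩))
  obtain ⟨a₃, b₃, e₃⟩ := Ideal.mem_span_pair.1 (hr.pow n (c - b₂ * r)
    (Ideal.mem_span_pair.2 ⟨a₂, a₁, by linear_combination e₂⟩))
  exact Submodule.mem_span_triple.2 ⟨b₂, a₃, b₃, by
    simp only [smul_eq_mul]; linear_combination e₃⟩

end RegularMod

section Linkage

theorem dvd_of_dvd_pow_mul {R : Type*} [CommRing R] {u v : R}
    (h : ∀ c, u ∣ v * c → u ∣ c) (n : ℕ) (c : R) (hc : u ∣ v ^ n * c) : u ∣ c := by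
  induction n generalizing c with
  | zero => simpa using hc
  | succ n ih => exact h _ (ih _ (by rwa [pow_succ, mul_assoc] at hc))

variable {R : Type*} [CommRing R] [IsDomain R] {u v : R}

theorem dvd_of_dvd_mul_swap (hu : u ≠ 0) (h : ∀ c, u ∣ v * c → u ∣ c) (c : R)
    (hc : v ∣ u * c) : v ∣ c := by
  obtain ⟨d, hd⟩ := hc
  obtain ⟨e, rfl⟩ := h d ⟨c, hd.symm⟩
  exact ⟨e, mul_left_cancel₀ hu (by linear_combination hd)⟩

theorem pow_dvd_of_pow_dvd_mul (hu : u ≠ 0) (h : ∀ c, u ∣ v * c → u ∣ c) (n : ℕ) (c : R)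
    (hc : u ^ n ∣ v * c) : u ^ n ∣ c := by
  induction n generalizing c with
  | zero => simp
  | succ n ih =>
    obtain ⟨d, rfl⟩ := h c ((dvd_pow_self u n.succ_ne_zero).trans hc)
    rw [pow_succ', ← mul_assoc, mul_comm v u, mul_assoc] at hc
    rw [pow_succ']
    exact mul_dvd_mul_left _ (ih d ((mul_dvd_mul_iff_left hu).1 hc))

theorem pow_dvd_of_pow_dvd_pow_mul (hu : u ≠ 0) (h : ∀ c, u ∣ v * c → u ∣ c) (m n : ℕ) (c : R)
    (hc : u ^ m ∣ v ^ n * c) : u ^ m ∣ c :=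
  pow_dvd_of_pow_dvd_mul (v := v ^ n) hu (dvd_of_dvd_pow_mul h n) m c hc

/-- `(u ^ (n + 1), v ^ (n + 1)) : (u, v) = (u ^ (n + 1), v ^ (n + 1), (u v) ^ n)`
for coprime `u`, `v`. -/
theorem exists_sub_mul_pow_mem (hu : u ≠ 0) (h : ∀ c, u ∣ v * c → u ∣ c)
    (n : ℕ) (f : R) (h1 : u * f ∈ Ideal.span {u ^ (n + 1), v ^ (n + 1)})
    (h2 : v * f ∈ Ideal.span {u ^ (n + 1), v ^ (n + 1)}) :
    ∃ a, f - a * (u * v) ^ n ∈ Ideal.span {u ^ (n + 1), v ^ (n + 1)} := by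
  obtain ⟨α, β, e1⟩ := Ideal.mem_span_pair.1 h1
  obtain ⟨β', rfl⟩ : u ∣ β := dvd_of_dvd_pow_mul h (n + 1) β
    ⟨f - α * u ^ n, by linear_combination e1⟩
  have e1 : f = α * u ^ n + β' * v ^ (n + 1) :=
    mul_left_cancel₀ hu (by linear_combination -e1)
  obtain ⟨γ, δ, e2⟩ := Ideal.mem_span_pair.1 h2
  obtain ⟨δ', hδ⟩ : u ^ n ∣ δ - v * β' := pow_dvd_of_pow_dvd_pow_mul hu h n (n + 1) _
    ⟨v * α - γ * u, by rw [e1] at e2; linear_combination e2⟩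
  have e3 : v * α = γ * u + δ' * v ^ (n + 1) :=
    mul_left_cancel₀ (pow_ne_zero n hu) (by
      rw [e1] at e2; linear_combination -e2 + v ^ (n + 1) * hδ)
  obtain ⟨ε, hε⟩ := h (α - δ' * v ^ n) ⟨γ, by linear_combination e3⟩
  refine ⟨δ', Ideal.mem_span_pair.2 ⟨ε, β', ?_⟩⟩
  rw [e1]
  linear_combination -u ^ n * hε

/-- `(u ^ (n + 1), v ^ (n + 1)) : (u v) ^ n = (u, v)` for coprime `u`, `v`. -/
theorem mem_span_pair_of_mul_pow_mem (hu : u ≠ 0) (hv : v ≠ 0) (h : ∀ c, u ∣ v * c → u ∣ c)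
    (n : ℕ) (c : R) (hc : c * (u * v) ^ n ∈ Ideal.span {u ^ (n + 1), v ^ (n + 1)}) :
    c ∈ Ideal.span {u, v} := by
  obtain ⟨α, β, e⟩ := Ideal.mem_span_pair.1 hc
  obtain ⟨β', rfl⟩ := pow_dvd_of_pow_dvd_pow_mul hu h n (n + 1) β
    ⟨c * v ^ n - α * u, by linear_combination e⟩
  obtain ⟨α', rfl⟩ := pow_dvd_of_pow_dvd_mul hv (dvd_of_dvd_mul_swap hu h) n α
    ⟨c - β' * v, mul_left_cancel₀ (pow_ne_zero n hu) (by linear_combination e)⟩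
  refine Ideal.mem_span_pair.2 ⟨α', β', ?_⟩
  exact mul_left_cancel₀ (pow_ne_zero n (mul_ne_zero hu hv)) (by linear_combination e)

end Linkage

/-- The first row of a `3 × 2` matrix with rows `(x, w)`, `(y, s)`, `(z, t)` is regular modulo
the `2 × 2` minors. -/
theorem regularMod_minors {R : Type*} [CommRing R] [IsDomain R] {x y z w s t : R} (hx : x ≠ 0)
    (hG : RegularMod {x, w} (y * t - z * s)) (hw : RegularMod {x} w)
    (hy : RegularMod {x, z} y) (hz : RegularMod {x} z) :
    RegularMod {y * t - z * s, x * t - z * w, x * s - y * w} x := by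
  intro f hf
  obtain ⟨a, b, c, e⟩ := Submodule.mem_span_triple.1 hf
  simp only [smul_eq_mul] at e
  obtain ⟨a₂, a₁, rfl⟩ := Ideal.mem_span_pair.1 (hG a (Ideal.mem_span_pair.2
    ⟨f - b * t - c * s, b * z + c * y, by linear_combination -e⟩))
  obtain ⟨d, hd⟩ := Ideal.mem_span_singleton.1
    (hw (a₁ * (y * t - z * s) - b * z - c * y) (Ideal.mem_span_singleton.2
      ⟨f - b * t - c * s - a₂ * (y * t - z * s), by linear_combination e⟩))
  obtain ⟨i, g, hi⟩ := Ideal.mem_span_pair.1 (hy (a₁ * t - c) (Ideal.mem_span_pair.2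
    ⟨d, b + a₁ * s, by linear_combination -hd⟩))
  obtain ⟨j, hj⟩ := Ideal.mem_span_singleton.1 (hz (b + a₁ * s - y * g)
    (Ideal.mem_span_singleton.2 ⟨y * i - d, by linear_combination -hd - y * hi⟩))
  refine Submodule.mem_span_triple.2 ⟨a₂ + g, j, -i, ?_⟩
  simp only [smul_eq_mul]
  refine mul_left_cancel₀ hx ?_
  linear_combination e - (x * t - z * w) * hj - (x * s - y * w) * hi

theorem frobPow_span {R : Type} [CommRing R] (p : ℕ) [ExpChar R p] (s : Set R) :
    frobPow p (Ideal.span s) = Ideal.span ((· ^ p) '' s) :=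
  Ideal.map_span (frobenius R p) s

section Variables

variable {k : Type} [Field k]

/-- A power series lies in the ideal of finitely many variables as soon as each of its monomials
involves one of them. -/
theorem mem_span_X_of_coeff_eq_zero {σ : Type*} (s : Finset σ)
    (f : MvPowerSeries σ k)
    (hf : ∀ e : σ →₀ ℕ, (∀ i ∈ s, e i = 0) → f.coeff e = 0) :
    f ∈ Ideal.span ((MvPowerSeries.X : σ → MvPowerSeries σ k) '' s) := by
  classical
  induction s using Finset.induction_on generalizing f with
  | empty =>
    have : f = 0 := by ext e; simpa using hf e (by simp)
    simp [this]
  | insert a s ha ih =>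
    let g : MvPowerSeries σ k := fun e => if e a = 0 then f.coeff e else 0
    have hg : ∀ e, g.coeff e = if e a = 0 then f.coeff e else 0 := fun e => rfl
    have hdvd : MvPowerSeries.X a ∣ f - g := by
      rw [MvPowerSeries.X_dvd_iff]
      intro m hm
      simp [hg, hm]
    obtain ⟨q, hq⟩ := hdvd
    rw [Finset.coe_insert, Set.image_insert_eq]
    refine Ideal.mem_span_insert.2 ⟨q, g, ih g ?_, by linear_combination hq⟩
    intro e he
    rw [hg]
    split_ifs with h
    · exact hf e (by simpa [h] using he)
    · rfl

theorem coeff_eq_zero_of_mem_span_X {σ : Type*} (s : Set σ) (f : MvPowerSeries σ k)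
    (hf : f ∈ Ideal.span ((MvPowerSeries.X : σ → MvPowerSeries σ k) '' s))
    (e : σ →₀ ℕ) (he : ∀ i ∈ s, e i = 0) : f.coeff e = 0 := by
  classical
  induction hf using Submodule.span_induction generalizing e with
  | mem x hx =>
    obtain ⟨i, hi, rfl⟩ := hx
    exact MvPowerSeries.X_dvd_iff.1 dvd_rfl e (he i hi)
  | zero => simp
  | add x y _ _ hx hy => simp [hx e he, hy e he]
  | smul a x _ hx =>
    rw [smul_eq_mul, MvPowerSeries.coeff_mul]
    refine Finset.sum_eq_zero fun d hd => ?_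
    rw [hx d.2 fun i hi => ?_, mul_zero]
    have := DFunLike.congr_fun (Finset.HasAntidiagonal.mem_antidiagonal.1 hd) i
    rw [Finsupp.add_apply, he i hi] at this
    omega

theorem regularMod_X (s : Finset (Fin 6)) {i : Fin 6} (hi : i ∉ s) :
    RegularMod ((MvPowerSeries.X : Fin 6 → MvPowerSeries (Fin 6) k) '' s)
      (MvPowerSeries.X i) := by
  intro c hc
  refine mem_span_X_of_coeff_eq_zero s c fun e he => ?_
  have := coeff_eq_zero_of_mem_span_X _ _ hc (e + Finsupp.single i 1) ?_
  · rwa [add_comm, MvPowerSeries.X, MvPowerSeries.coeff_add_monomial_mul, one_mul] at this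
  · intro j hj
    have : i ≠ j := fun h => hi (h ▸ hj)
    simp [he j hj, this]

theorem X_mem_jacobson (i : Fin 6) :
    (MvPowerSeries.X i : MvPowerSeries (Fin 6) k) ∈
      Ideal.jacobson (⊥ : Ideal (MvPowerSeries (Fin 6) k)) := by
  rw [IsLocalRing.jacobson_eq_maximalIdeal _ bot_ne_top, IsLocalRing.mem_maximalIdeal,
    mem_nonunits_iff, MvPowerSeries.isUnit_iff_constantCoeff]
  simp

instance : IsDomain (MvPowerSeries (Fin 6) k) := NoZeroDivisors.to_isDomain _

theorem mvPowerSeries_X_ne_zero (i : Fin 6) : (MvPowerSeries.X i : MvPowerSeries (Fin 6) k) ≠ 0 :=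
  nonZeroDivisors.ne_zero MvPowerSeries.X_mem_nonzeroDivisors

theorem charP_mvPowerSeries (p : ℕ) [CharP k p] : CharP (MvPowerSeries (Fin 6) k) p :=
  charP_of_injective_algebraMap' k p

end Variables

section Minors

variable {k : Type} [Field k]

theorem px_ne_zero : px k ≠ 0 := mvPowerSeries_X_ne_zero _

theorem pw_ne_zero : pw k ≠ 0 := mvPowerSeries_X_ne_zero _

theorem regularMod_singleton_X {i j : Fin 6} (h : i ≠ j) :
    RegularMod {(MvPowerSeries.X j : MvPowerSeries (Fin 6) k)} (MvPowerSeries.X i) := by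
  simpa using regularMod_X (k := k) {j} (i := i) (by simpa)

theorem regularMod_pair_X {i j l : Fin 6} (h : i ≠ j ∧ i ≠ l) :
    RegularMod {(MvPowerSeries.X j : MvPowerSeries (Fin 6) k), MvPowerSeries.X l}
      (MvPowerSeries.X i) := by
  simpa [Set.image_insert_eq] using regularMod_X (k := k) {j, l} (i := i) (by simpa)

theorem regularMod_triple_X {i j l m : Fin 6} (h : i ≠ j ∧ i ≠ l ∧ i ≠ m) :
    RegularMod {(MvPowerSeries.X j : MvPowerSeries (Fin 6) k), MvPowerSeries.X l,
      MvPowerSeries.X m} (MvPowerSeries.X i) := by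
  simpa [Set.image_insert_eq] using regularMod_X (k := k) {j, l, m} (i := i) (by simpa)

theorem regularMod_px_pw : RegularMod {px k} (pw k) := regularMod_singleton_X (by decide)

theorem regularMod_pw_px : RegularMod {pw k} (px k) := regularMod_singleton_X (by decide)

theorem regularMod_G1 : RegularMod {px k, pw k} (G1 k) := by
  refine RegularMod.of_insert (u := py k) (X_mem_jacobson _) (regularMod_pair_X (by decide)) ?_
  refine RegularMod.congr (r := -(pz k * ps k)) (RegularMod.neg (RegularMod.mul
    (regularMod_triple_X (by decide)) (regularMod_triple_X (by decide)))) ?_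
  exact Ideal.mem_span_insert.2 ⟨pt k, 0, zero_mem _, by rw [G1]; ring⟩

theorem G3_ne_zero : G3 k ≠ 0 := by
  intro h
  have h1 : RegularMod {pw k} (px k * ps k) :=
    RegularMod.mul (regularMod_singleton_X (by decide)) (regularMod_singleton_X (by decide))
  have h2 := h1 1 (Ideal.mem_span_singleton.2 ⟨py k, by rw [G3] at h; linear_combination h⟩)
  obtain ⟨c, hc⟩ := Ideal.mem_span_singleton.1 h2
  have := congrArg MvPowerSeries.constantCoeff hc
  simp [pw] at this

theorem G2_ne_zero : G2 k ≠ 0 := by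
  intro h
  have h1 : RegularMod {pw k} (px k * pt k) :=
    RegularMod.mul (regularMod_singleton_X (by decide)) (regularMod_singleton_X (by decide))
  have h2 := h1 1 (Ideal.mem_span_singleton.2 ⟨pz k, by rw [G2] at h; linear_combination h⟩)
  obtain ⟨c, hc⟩ := Ideal.mem_span_singleton.1 h2
  have := congrArg MvPowerSeries.constantCoeff hc
  simp [pw] at this

theorem regularMod_G3_G2 : RegularMod {G3 k} (G2 k) := by
  have hxs {j : Set (MvPowerSeries (Fin 6) k)} (hw : pw k ∈ j)
      (h : RegularMod j (px k * ps k)) : RegularMod j (G3 k) :=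
    h.congr (by
      have := Ideal.mul_mem_left _ (-py k) (Ideal.subset_span hw)
      rw [G3]; ring_nf at this ⊢; exact this)
  have hwt : RegularMod {pw k, pt k} (G3 k) := hxs (by simp)
    (RegularMod.mul (regularMod_pair_X (by decide)) (regularMod_pair_X (by decide)))
  have hzt : RegularMod {pz k, pt k} (G3 k) :=
    RegularMod.of_insert (u := pw k) (X_mem_jacobson _) (regularMod_pair_X (by decide))
      (hxs (by simp) (RegularMod.mul (regularMod_triple_X (by decide))
        (regularMod_triple_X (by decide))))
  have ht : RegularMod {pt k} (G3 k) :=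
    RegularMod.of_insert (u := pw k) (X_mem_jacobson _) (regularMod_singleton_X (by decide)) hwt
  have hw' : RegularMod {G3 k, pt k} (pw k) :=
    RegularMod.swap (regularMod_singleton_X (by decide)) hwt
  have hz' : RegularMod {G3 k, pt k} (pz k) :=
    RegularMod.swap (regularMod_singleton_X (by decide)) hzt
  have ht' : RegularMod {G3 k} (pt k) := by
    rw [← insert_empty_eq] at ht ⊢
    exact RegularMod.swap (.of_ne_zero (mvPowerSeries_X_ne_zero _)) ht
  refine RegularMod.of_insert (u := pt k) (X_mem_jacobson _) ht' ?_
  rw [Set.pair_comm]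
  refine (hz'.mul hw').neg.congr ?_
  exact Ideal.mem_span_pair.2 ⟨0, px k, by rw [G2]; ring⟩

theorem G3_dvd_of_dvd_G2_mul (c : MvPowerSeries (Fin 6) k) (h : G3 k ∣ G2 k * c) : G3 k ∣ c :=
  Ideal.mem_span_singleton.1 (regularMod_G3_G2 c (Ideal.mem_span_singleton.2 h))

theorem regularMod_I32 : RegularMod {G1 k, G2 k, G3 k} (px k) :=
  regularMod_minors px_ne_zero regularMod_G1 regularMod_px_pw
    (regularMod_pair_X (by decide)) (regularMod_singleton_X (by decide))

/-- An element of `(x, w, G₁)` lies in `(x) + I` as soon as it lies in `(x, y, z)`, and for the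
latter it suffices that its product with `w` does. -/
theorem exists_sub_mul_px_mem {a : MvPowerSeries (Fin 6) k}
    (h1 : a ∈ Ideal.span {G1 k, px k, pw k})
    (h2 : pw k * a ∈ Ideal.span {px k, py k, pz k}) :
    ∃ b, a - px k * b ∈ Ideal.span {G1 k, G2 k, G3 k} := by
  have hw : RegularMod {px k, py k, pz k} (pw k) := regularMod_triple_X (by decide)
  obtain ⟨α, β, γ, rfl⟩ := Submodule.mem_span_triple.1 h1
  simp only [smul_eq_mul] at *
  have h3 : pw k * γ ∈ Ideal.span {px k, py k, pz k} := by
    obtain ⟨a, b, c, e⟩ := Submodule.mem_span_triple.1 (hw _ h2)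
    simp only [smul_eq_mul] at e
    refine Submodule.mem_span_triple.2 ⟨a - β, b - α * pt k, c + α * ps k, ?_⟩
    simp only [smul_eq_mul]
    rw [G1] at e
    linear_combination e
  obtain ⟨a, b, c, e⟩ := Submodule.mem_span_triple.1 (hw _ h3)
  simp only [smul_eq_mul] at e
  refine ⟨β + a * pw k + b * ps k + c * pt k,
    Submodule.mem_span_triple.2 ⟨α, -c, -b, ?_⟩⟩
  simp only [smul_eq_mul]
  rw [← e, G2, G3]
  ring

theorem px_mul_G1 : px k * G1 k = py k * G2 k - pz k * G3 k := by
  rw [G1, G2, G3]; ring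

theorem pw_mul_G1 : pw k * G1 k = ps k * G2 k - pt k * G3 k := by
  rw [G1, G2, G3]; ring

theorem Om32_eq : Om32 k = Ideal.span {G1 k, px k, pw k} := by
  rw [Om32, I32, P32, ← Ideal.span_union]
  apply le_antisymm <;> rw [Ideal.span_le]
  · intro f hf
    simp only [Set.mem_union, Set.mem_insert_iff, Set.mem_singleton_iff] at hf
    rw [SetLike.mem_coe, Submodule.mem_span_triple]
    rcases hf with (rfl | rfl | rfl) | rfl | rfl
    · exact ⟨1, 0, 0, by simp⟩
    · exact ⟨0, pt k, -pz k, by simp only [G2, smul_eq_mul]; ring⟩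
    · exact ⟨0, ps k, -py k, by simp only [G3, smul_eq_mul]; ring⟩
    · exact ⟨0, 1, 0, by simp⟩
    · exact ⟨0, 0, 1, by simp⟩
  · rw [Set.insert_subset_iff, Set.pair_subset_iff]
    refine ⟨?_, ?_, ?_⟩ <;> exact Ideal.subset_span (by simp)

end Minors

section Frobenius

variable {k : Type} [Field k]

theorem frobPow_I32 (p : ℕ) [ExpChar (MvPowerSeries (Fin 6) k) p] :
    frobPow p (I32 k) = Ideal.span {G1 k ^ p, G2 k ^ p, G3 k ^ p} := by
  rw [I32, frobPow_span]
  simp [Set.image_insert_eq]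

theorem frobPow_Om32 (p : ℕ) [ExpChar (MvPowerSeries (Fin 6) k) p] :
    frobPow p (Om32 k) = Ideal.span {G1 k ^ p, px k ^ p, pw k ^ p} := by
  rw [Om32_eq, frobPow_span]
  simp [Set.image_insert_eq]

theorem regularMod_frobPow_I32 (p : ℕ) [ExpChar (MvPowerSeries (Fin 6) k) p] :
    RegularMod {G1 k ^ p, G2 k ^ p, G3 k ^ p} (px k) := by
  have h : RegularMod {G1 k ^ p, G2 k ^ p, G3 k ^ p} (px k ^ p) := by
    have hG : RegularMod {px k ^ p, pw k ^ p} (G1 k ^ p) :=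
      (regularMod_G1.pow p).pair_pow px_ne_zero regularMod_px_pw regularMod_pw_px p p
    have hw : RegularMod {px k ^ p} (pw k ^ p) :=
      (regularMod_px_pw.pow p).singleton_pow px_ne_zero p
    have hxz : RegularMod {px k} (pz k) := regularMod_singleton_X (by decide)
    have hzx : RegularMod {pz k} (px k) := regularMod_singleton_X (by decide)
    have hxzy : RegularMod {px k, pz k} (py k) := regularMod_pair_X (by decide)
    have hy : RegularMod {px k ^ p, pz k ^ p} (py k ^ p) :=
      (hxzy.pow p).pair_pow px_ne_zero hxz hzx p p
    have hz : RegularMod {px k ^ p} (pz k ^ p) := (hxz.pow p).singleton_pow px_ne_zero p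
    have e1 : G1 k ^ p = py k ^ p * pt k ^ p - pz k ^ p * ps k ^ p := by
      rw [G1, sub_pow_expChar, mul_pow, mul_pow]
    have e2 : G2 k ^ p = px k ^ p * pt k ^ p - pz k ^ p * pw k ^ p := by
      rw [G2, sub_pow_expChar, mul_pow, mul_pow]
    have e3 : G3 k ^ p = px k ^ p * ps k ^ p - py k ^ p * pw k ^ p := by
      rw [G3, sub_pow_expChar, mul_pow, mul_pow]
    rw [e1] at hG ⊢
    rw [e2, e3]
    exact regularMod_minors (pow_ne_zero p px_ne_zero) hG hw hy hz
  intro c hc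
  refine h c ?_
  obtain ⟨m, hm⟩ := Nat.exists_eq_succ_of_ne_zero (expChar_pos (MvPowerSeries (Fin 6) k) p).ne'
  have := Ideal.mul_mem_left _ (px k ^ m) hc
  rwa [← mul_assoc, ← pow_succ, ← Nat.succ_eq_add_one, ← hm] at this

theorem mem_Om32_of_mul_pow_mem (n : ℕ) {c : MvPowerSeries (Fin 6) k}
    (hc : c * (G1 k * px k * pw k) ^ n ∈
      Ideal.span {G1 k ^ (n + 1), px k ^ (n + 1), pw k ^ (n + 1)}) :
    c ∈ Ideal.span {G1 k, px k, pw k} := by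
  refine RegularMod.mem_span_triple_of_mul_pow_mem (n := n) ?_ ?_ regularMod_G1 hc
  · rw [Set.pair_comm]
    refine (regularMod_pw_px.singleton_pow pw_ne_zero _).swap ?_
    have := (regularMod_G1 (k := k).pow (n + 1)).pair_pow px_ne_zero regularMod_px_pw
      regularMod_pw_px 1 (n + 1)
    rwa [pow_one] at this
  · rw [Set.pair_comm]
    refine regularMod_px_pw.swap ?_
    rw [Set.pair_comm]
    exact regularMod_G1.pow (n + 1)

variable (n : ℕ) [ExpChar (MvPowerSeries (Fin 6) k) (n + 1)]

theorem pow_sub_pow_mem :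
    (G3 k * G2 k) ^ n - (-1) ^ n * (G1 k * px k * pw k) ^ n ∈
      Ideal.span {px k ^ (n + 1), pw k ^ (n + 1)} := by
  have hxwy : RegularMod {px k, pw k} (py k) := regularMod_pair_X (by decide)
  have hy : RegularMod {px k ^ (n + 1), pw k ^ (n + 1)} (py k ^ n) :=
    (hxwy.pow n).pair_pow px_ne_zero regularMod_px_pw regularMod_pw_px _ _
  refine hy _ ?_
  obtain ⟨q, hq⟩ := sub_dvd_pow_sub_pow (py k * G2 k) (px k * G1 k) n
  obtain ⟨q', hq'⟩ := sub_dvd_pow_sub_pow (G3 k) (-1 * (py k * pw k)) n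
  have h3 : G3 k ^ (n + 1) = px k ^ (n + 1) * ps k ^ (n + 1) - py k ^ (n + 1) * pw k ^ (n + 1) := by
    rw [G3, sub_pow_expChar, mul_pow, mul_pow]
  have h4 : py k * G2 k - px k * G1 k = pz k * G3 k := by rw [px_mul_G1]; ring
  have h5 : G3 k - -1 * (py k * pw k) = px k * ps k := by rw [G3]; ring
  rw [h4] at hq
  rw [h5] at hq'
  simp only [mul_pow] at hq hq' ⊢
  refine Ideal.mem_span_pair.2 ⟨ps k ^ (n + 1) * pz k * q + G1 k ^ n * ps k * q',
    -(py k ^ (n + 1) * pz k * q), ?_⟩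
  linear_combination -G3 k ^ n * hq - px k ^ n * G1 k ^ n * hq' - pz k * q * h3

theorem mul_pow_mem_frobPow_I32 {c : MvPowerSeries (Fin 6) k}
    (hc : c ∈ Ideal.span {G1 k, G2 k, G3 k}) :
    c * (G3 k * G2 k) ^ n ∈ Ideal.span {G1 k ^ (n + 1), G2 k ^ (n + 1), G3 k ^ (n + 1)} := by
  obtain ⟨a, b, d, rfl⟩ := Submodule.mem_span_triple.1 hc
  refine regularMod_frobPow_I32 (n + 1) _ (Submodule.mem_span_triple.2
    ⟨0, (a * py k + b * px k) * G3 k ^ n, (d * px k - a * pz k) * G2 k ^ n, ?_⟩)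
  simp only [smul_eq_mul, mul_pow]
  linear_combination -a * G2 k ^ n * G3 k ^ n * px_mul_G1 (k := k)

theorem mem_I32_of_mul_pow_mem {c : MvPowerSeries (Fin 6) k}
    (hc : c * (G3 k * G2 k) ^ n ∈
      Ideal.span {G1 k ^ (n + 1), G2 k ^ (n + 1), G3 k ^ (n + 1)}) :
    c ∈ Ideal.span {G1 k, G2 k, G3 k} := by
  refine regularMod_I32.pow (n + 1) c ?_
  have h : px k ^ (n + 1) * c ∈ Ideal.span {G3 k, G2 k} := by
    refine mem_span_pair_of_mul_pow_mem G3_ne_zero G2_ne_zero G3_dvd_of_dvd_G2_mul n _ ?_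
    have h1 := congrArg (· ^ (n + 1)) (px_mul_G1 (k := k))
    simp only [sub_pow_expChar, mul_pow] at h1
    obtain ⟨a, b, d, e⟩ := Submodule.mem_span_triple.1 hc
    simp only [smul_eq_mul] at e
    refine Ideal.mem_span_pair.2 ⟨d * px k ^ (n + 1) - a * pz k ^ (n + 1),
      b * px k ^ (n + 1) + a * py k ^ (n + 1), ?_⟩
    linear_combination px k ^ (n + 1) * e - a * h1
  refine Ideal.span_mono ?_ h
  simp [Set.pair_subset_iff]

/-- If `r G₁` is a combination of `G₂` and `G₃`, then `r ^ p (I^{[p]} : I) ⊆ I^{[p]} + (g)` with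
`g = (G₃ G₂) ^ (p - 1)`. -/
theorem exists_pow_mul_sub_mem {f r a b : MvPowerSeries (Fin 6) k}
    (hr : r * G1 k = a * G2 k - b * G3 k)
    (hf : ∀ c ∈ Ideal.span {G1 k, G2 k, G3 k},
      f * c ∈ Ideal.span {G1 k ^ (n + 1), G2 k ^ (n + 1), G3 k ^ (n + 1)}) :
    ∃ d, r ^ (n + 1) * f - d * (G3 k * G2 k) ^ n ∈
      Ideal.span {G1 k ^ (n + 1), G2 k ^ (n + 1), G3 k ^ (n + 1)} := by
  have h1 := congrArg (· ^ (n + 1)) hr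
  simp only [sub_pow_expChar, mul_pow] at h1
  have key (c) (hc : c ∈ ({G1 k, G2 k, G3 k} : Set _)) :
      c * (r ^ (n + 1) * f) ∈ Ideal.span {G3 k ^ (n + 1), G2 k ^ (n + 1)} := by
    obtain ⟨α, β, γ, e⟩ := Submodule.mem_span_triple.1 (hf c (Ideal.subset_span hc))
    simp only [smul_eq_mul] at e
    refine Ideal.mem_span_pair.2 ⟨γ * r ^ (n + 1) - α * b ^ (n + 1),
      β * r ^ (n + 1) + α * a ^ (n + 1), ?_⟩
    linear_combination r ^ (n + 1) * e - α * h1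
  obtain ⟨d, hd⟩ := exists_sub_mul_pow_mem G3_ne_zero G3_dvd_of_dvd_G2_mul n _
    (key _ (by simp)) (key _ (by simp))
  refine ⟨d, Ideal.span_mono ?_ hd⟩
  simp [Set.pair_subset_iff]

theorem span_frob_I32_le :
    Ideal.span {G1 k ^ (n + 1), G2 k ^ (n + 1), G3 k ^ (n + 1)} ≤
      Ideal.span {G1 k ^ (n + 1), px k ^ (n + 1), pw k ^ (n + 1)} := by
  rw [← frobPow_I32, ← frobPow_Om32]
  exact Ideal.span_mono (Set.image_mono (le_sup_left : I32 k ≤ Om32 k))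

theorem exists_sub_mul_mem {f : MvPowerSeries (Fin 6) k}
    (hI : ∀ c ∈ Ideal.span {G1 k, G2 k, G3 k},
      f * c ∈ Ideal.span {G1 k ^ (n + 1), G2 k ^ (n + 1), G3 k ^ (n + 1)})
    (hO : ∀ c ∈ Ideal.span {G1 k, px k, pw k},
      f * c ∈ Ideal.span {G1 k ^ (n + 1), px k ^ (n + 1), pw k ^ (n + 1)}) :
    ∃ a, f - a * (G3 k * G2 k) ^ n ∈
      Ideal.span {G1 k ^ (n + 1), G2 k ^ (n + 1), G3 k ^ (n + 1)} := by
  obtain ⟨b, hb⟩ := exists_pow_mul_sub_mem n pw_mul_G1 hI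
  suffices ∀ j ≤ n + 1, ∃ a, px k ^ j * f - a * (G3 k * G2 k) ^ n ∈
      Ideal.span {G1 k ^ (n + 1), G2 k ^ (n + 1), G3 k ^ (n + 1)} by
    simpa using this 0 (Nat.zero_le _)
  intro j hj
  induction hj using Nat.decreasingInduction with
  | self => exact exists_pow_mul_sub_mem n px_mul_G1 hI
  | of_succ j _ ih =>
    obtain ⟨a, ha⟩ := ih
    have haO : a ∈ Ideal.span {G1 k, px k, pw k} := by
      refine mem_Om32_of_mul_pow_mem n ?_
      have h1 : a * (G3 k * G2 k) ^ n ∈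
          Ideal.span {G1 k ^ (n + 1), px k ^ (n + 1), pw k ^ (n + 1)} := by
        have h2 := Ideal.mul_mem_left _ (px k ^ j) (hO (px k) (Ideal.subset_span (by simp)))
        have := sub_mem h2 (span_frob_I32_le n ha)
        ring_nf at this ⊢
        exact this
      have h3 := Ideal.mul_mem_left _ a
        (Ideal.span_mono (Set.subset_insert (G1 k ^ (n + 1)) _) (pow_sub_pow_mem (k := k) n))
      have h4 := Ideal.mul_mem_left _ ((-1) ^ n) (sub_mem h1 h3)
      have h5 : ((-1 : MvPowerSeries (Fin 6) k) ^ n) * (-1) ^ n = 1 := by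
        rw [← mul_pow]; simp
      convert h4 using 1
      linear_combination -a * (G1 k * px k * pw k) ^ n * h5
    have haQ : pw k ^ (n + 1) * a ∈ Ideal.span {px k, py k, pz k} := by
      have h1 : pw k ^ (n + 1) * a - px k ^ (j + 1) * b ∈ Ideal.span {G1 k, G2 k, G3 k} := by
        refine mem_I32_of_mul_pow_mem n ?_
        have := sub_mem (Ideal.mul_mem_left _ (px k ^ (j + 1)) hb)
          (Ideal.mul_mem_left _ (pw k ^ (n + 1)) ha)
        convert this using 1
        ring
      obtain ⟨α, β, γ, e⟩ := Submodule.mem_span_triple.1 h1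
      refine Submodule.mem_span_triple.2 ⟨px k ^ j * b + β * pt k + γ * ps k,
        α * pt k - γ * pw k, -α * ps k - β * pw k, ?_⟩
      simp only [smul_eq_mul, G1, G2, G3] at *
      linear_combination e
    have hw : RegularMod {px k, py k, pz k} (pw k) := regularMod_triple_X (by decide)
    obtain ⟨c, hc⟩ := exists_sub_mul_px_mem haO (Ideal.mul_mem_left _ _ (hw.pow (n + 1) a haQ))
    refine ⟨c, regularMod_frobPow_I32 (n + 1) _ ?_⟩
    convert add_mem ha (mul_pow_mem_frobPow_I32 n hc) using 1
    ring

end Frobenius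

/-- `(I^{[p]} : I) ∩ (Ω^{[p]} : Ω) = I^{[p]} + ((G₃G₂)^{p-1})` where
`G₃G₂ = (xs - yw)(xt - zw)`. -/
theorem stmt9 (p : ℕ) (hp : p.Prime) (k : Type) [Field k] [CharP k p] :
    Submodule.colon (frobPow p (I32 k)) (I32 k) ⊓
        Submodule.colon (frobPow p (Om32 k)) (Om32 k) =
      frobPow p (I32 k) ⊔
        Ideal.span {((px k * ps k - py k * pw k) * (px k * pt k - pz k * pw k)) ^ (p - 1)} := by
  have := charP_mvPowerSeries (k := k) p
  obtain ⟨n, rfl⟩ : ∃ n, p = n + 1 := ⟨p - 1, by have := hp.pos; omega⟩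
  have : ExpChar (MvPowerSeries (Fin 6) k) (n + 1) := .prime hp
  change _ = _ ⊔ Ideal.span {(G3 k * G2 k) ^ n}
  rw [frobPow_I32, frobPow_Om32, Om32_eq, I32]
  ext f
  simp only [Submodule.mem_inf, Submodule.mem_colon, smul_eq_mul, SetLike.mem_coe]
  constructor
  · rintro ⟨hI, hO⟩
    obtain ⟨a, ha⟩ := exists_sub_mul_mem n hI hO
    rw [sup_comm, Ideal.mem_span_singleton_sup]
    exact ⟨a, _, ha, by ring⟩
  · intro hf
    rw [sup_comm, Ideal.mem_span_singleton_sup] at hf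
    obtain ⟨a, b, hb, rfl⟩ := hf
    constructor <;> intro c hc <;> rw [add_mul]
    · refine add_mem ?_ (Ideal.mul_mem_right _ _ hb)
      rw [mul_assoc, mul_comm _ c]
      exact Ideal.mul_mem_left _ _ (mul_pow_mem_frobPow_I32 n hc)
    · refine add_mem ?_ (Ideal.mul_mem_right _ _ (span_frob_I32_le n hb))
      rw [mul_assoc]
      refine Ideal.mul_mem_left _ _ ?_
      have h1 := Ideal.mul_mem_right c _ (Ideal.span_mono
        (Set.subset_insert (G1 k ^ (n + 1)) _) (pow_sub_pow_mem (k := k) n))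
      rw [sub_mul] at h1
      refine (Submodule.sub_mem_iff_left _ ?_).1 h1
      obtain ⟨α, β, γ, rfl⟩ := Submodule.mem_span_triple.1 hc
      refine Submodule.mem_span_triple.2 ⟨(-1) ^ n * α * (px k * pw k) ^ n,
        (-1) ^ n * β * (G1 k * pw k) ^ n, (-1) ^ n * γ * (G1 k * px k) ^ n, ?_⟩
      simp only [smul_eq_mul]
      ring
end

section
/- Setting K = (G_3, G_2) ⊆ R = k[[x, y, z, w, s, t]], one has K = I ∩ P and K^{[p]} = I^{[p]} ∩ P^{[p]}. -/
namespace MvPowerSeries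

variable {σ R : Type*}

open Classical in
/-- The part of a power series consisting of the monomials free of the variables in `s`. -/
noncomputable def freePart [CommSemiring R] (s : Set σ) (a : MvPowerSeries σ R) :
    MvPowerSeries σ R :=
  fun m => if ∀ i ∈ s, m i = 0 then coeff m a else 0

open Classical in
theorem coeff_freePart [CommSemiring R] (s : Set σ) (a : MvPowerSeries σ R) (m : σ →₀ ℕ) :
    coeff m (freePart s a) = if ∀ i ∈ s, m i = 0 then coeff m a else 0 :=
  rfl

open Classical in
/-- The ring endomorphism of `R⟦σ⟧` that sets the variables in `s` to zero. -/
noncomputable def killVars [CommSemiring R] (s : Set σ) :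
    MvPowerSeries σ R →+* MvPowerSeries σ R where
  toFun := freePart s
  map_zero' := by
    ext m
    simp [coeff_freePart]
  map_add' a b := by
    ext m
    simp only [map_add, coeff_freePart]
    split_ifs <;> simp
  map_one' := by
    ext m
    rw [coeff_freePart]
    split_ifs with h
    · rfl
    · rw [coeff_one, if_neg]
      rintro rfl
      exact h fun i _ => rfl
  map_mul' a b := by
    ext m
    simp only [coeff_freePart, coeff_mul]
    split_ifs with h
    · refine Finset.sum_congr rfl fun q hq => ?_
      rw [Finset.HasAntidiagonal.mem_antidiagonal] at hq
      have hm : ∀ i ∈ s, q.1 i + q.2 i = 0 := fun i hi => by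
        rw [← Finsupp.add_apply, hq, h i hi]
      rw [if_pos fun i hi => Nat.eq_zero_of_add_eq_zero_right (hm i hi),
        if_pos fun i hi => Nat.eq_zero_of_add_eq_zero_left (hm i hi)]
    · refine (Finset.sum_eq_zero fun q hq => ?_).symm
      rw [Finset.HasAntidiagonal.mem_antidiagonal] at hq
      split_ifs with h1 h2
      · exact absurd (fun i hi => by rw [← hq, Finsupp.add_apply, h1 i hi, h2 i hi]) h
      all_goals simp

open Classical in
theorem coeff_killVars [CommSemiring R] (s : Set σ) (a : MvPowerSeries σ R) (m : σ →₀ ℕ) :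
    coeff m (killVars s a) = if ∀ i ∈ s, m i = 0 then coeff m a else 0 :=
  rfl

theorem killVars_eq_zero_iff [CommSemiring R] {s : Set σ} {a : MvPowerSeries σ R} :
    killVars s a = 0 ↔ ∀ m : σ →₀ ℕ, (∀ i ∈ s, m i = 0) → coeff m a = 0 := by
  refine ⟨fun h m hm => ?_, fun h => ?_⟩
  · rw [← if_pos (c := ∀ i ∈ s, m i = 0) (t := coeff m a) (e := 0) hm, ← coeff_killVars, h,
      map_zero]
  · ext m
    rw [coeff_killVars, map_zero]
    split_ifs with hm
    exacts [h m hm, rfl]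

theorem killVars_singleton_eq_zero_iff [CommSemiring R] {i : σ} {a : MvPowerSeries σ R} :
    killVars {i} a = 0 ↔ X i ∣ a := by
  simp [killVars_eq_zero_iff, X_dvd_iff]

theorem killVars_X_of_notMem [CommSemiring R] {s : Set σ} {i : σ} (hi : i ∉ s) :
    killVars s (X i : MvPowerSeries σ R) = X i := by
  classical
  ext m
  rw [coeff_killVars, coeff_X]
  split_ifs with h h' h' <;> try rfl
  subst h'
  refine absurd (fun j hj => ?_) h
  exact Finsupp.single_eq_of_ne fun e => hi (e ▸ hj)

theorem killVars_X_of_mem [CommSemiring R] {s : Set σ} {i : σ} (hi : i ∈ s) :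
    killVars s (X i : MvPowerSeries σ R) = 0 := by
  classical
  rw [killVars_eq_zero_iff]
  intro m hm
  rw [coeff_X, if_neg]
  rintro rfl
  simpa using hm i hi

theorem killVars_pair_eq_zero_iff [CommRing R] {i j : σ} {a : MvPowerSeries σ R} :
    killVars {i, j} a = 0 ↔ a ∈ Ideal.span {(X i : MvPowerSeries σ R), X j} := by
  rw [Ideal.mem_span_pair]
  constructor
  · intro h
    rw [killVars_eq_zero_iff] at h
    have hi : X i ∣ a - killVars {i} a := by
      classical
      rw [X_dvd_iff]
      intro m hm
      rw [map_sub, coeff_killVars, if_pos (by simpa using hm), sub_self]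
    have hj : X j ∣ killVars {i} a := by
      classical
      rw [X_dvd_iff]
      intro m hm
      rw [coeff_killVars]
      split_ifs with hm'
      · exact h m (by simpa [hm] using hm')
      · rfl
    obtain ⟨b, hb⟩ := hi
    obtain ⟨c, hc⟩ := hj
    exact ⟨b, c, by linear_combination -hb - hc⟩
  · rintro ⟨b, c, rfl⟩
    rw [map_add, map_mul, map_mul, killVars_X_of_mem (by simp), killVars_X_of_mem (by simp),
      mul_zero, mul_zero, add_zero]

theorem X_dvd_X_iff [CommSemiring R] [Nontrivial R] {i j : σ} :
    (X i : MvPowerSeries σ R) ∣ X j ↔ i = j := by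
  classical
  refine ⟨fun h => ?_, fun h => h ▸ dvd_rfl⟩
  by_contra hij
  have := X_dvd_iff.mp h (Finsupp.single j 1) (Finsupp.single_eq_of_ne hij)
  rw [coeff_X, if_pos rfl] at this
  exact one_ne_zero this

theorem prime_X [CommRing R] [IsDomain R] (i : σ) : Prime (X i : MvPowerSeries σ R) := by
  refine ⟨fun h => ?_, fun h => ?_, fun a b h => ?_⟩
  · have h' : killVars ∅ (X i : MvPowerSeries σ R) = 0 := by rw [h, map_zero]
    rw [killVars_eq_zero_iff] at h'
    classical
    have := h' (Finsupp.single i 1) (by simp)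
    rw [coeff_X, if_pos rfl] at this
    exact one_ne_zero this
  · have := killVars_singleton_eq_zero_iff.mpr (isUnit_iff_dvd_one.mp h)
    rw [map_one] at this
    exact one_ne_zero this
  · simpa only [← killVars_singleton_eq_zero_iff, map_mul, mul_eq_zero] using h

end MvPowerSeries

section Regular

variable {A : Type*} [CommRing A]

theorem mem_of_mul_pow_mem {J : Ideal A} {g : A} (hg : ∀ a, a * g ∈ J → a ∈ J) (n : ℕ) :
    ∀ a, a * g ^ n ∈ J → a ∈ J := by
  induction n with
  | zero => simp
  | succ n ih =>
    intro a ha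
    exact ih a (hg _ (by rwa [mul_assoc, ← pow_succ]))

/-- If `x` is regular modulo `c` and `g` is regular modulo `(x, c)`, then `g` is regular modulo
`(xⁿ, c)`. -/
theorem mem_span_pow_pair_of_mul_mem {x c g : A} (hx : ∀ u, c ∣ x * u → c ∣ u)
    (hg : ∀ a, a * g ∈ Ideal.span {x, c} → a ∈ Ideal.span {x, c}) (n : ℕ) :
    ∀ a, a * g ∈ Ideal.span {x ^ n, c} → a ∈ Ideal.span {x ^ n, c} := by
  have hpow : ∀ n u, c ∣ x ^ n * u → c ∣ u := by
    intro n
    induction n with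
    | zero => simp
    | succ n ih => exact fun u hu => hx _ (ih _ (by rwa [← mul_assoc, ← pow_succ]))
  induction n with
  | zero => simp [Ideal.span_insert]
  | succ n ih =>
    simp only [Ideal.mem_span_pair] at ih hg ⊢
    rintro a ⟨α, β, h⟩
    obtain ⟨u, v, rfl⟩ := ih a ⟨α * x, β, by rw [← h]; ring⟩
    obtain ⟨γ, hγ⟩ : c ∣ u * g - α * x :=
      hpow n _ ⟨β - v * g, by linear_combination -h⟩
    obtain ⟨u₁, u₂, rfl⟩ := hg u ⟨α, γ, by linear_combination -hγ⟩
    exact ⟨u₁, u₂ * x ^ n + v, by ring⟩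

theorem span_pair_eq_span_triple_inf {x w g₁ g₂ g₃ : A}
    (h₂ : g₂ ∈ Ideal.span {x, w}) (h₃ : g₃ ∈ Ideal.span {x, w})
    (hx : x * g₁ ∈ Ideal.span {g₃, g₂}) (hw : w * g₁ ∈ Ideal.span {g₃, g₂})
    (hg : ∀ a, a * g₁ ∈ Ideal.span {x, w} → a ∈ Ideal.span {x, w}) :
    Ideal.span {g₃, g₂} = Ideal.span {g₁, g₂, g₃} ⊓ Ideal.span {x, w} := by
  apply le_antisymm
  · refine le_inf (Ideal.span_mono ?_) ?_
    · rintro _ (rfl | rfl) <;> simp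
    · rw [Ideal.span_le]
      rintro _ (rfl | rfl) <;> assumption
  · rintro f ⟨hI, hP⟩
    obtain ⟨a, z, hz, rfl⟩ := Ideal.mem_span_insert.mp hI
    rw [Set.pair_comm] at hz
    have hle : Ideal.span {g₃, g₂} ≤ Ideal.span {x, w} := by
      rw [Ideal.span_le]
      rintro _ (rfl | rfl) <;> assumption
    refine add_mem ?_ hz
    obtain ⟨b, c, rfl⟩ := Ideal.mem_span_pair.mp (hg a ((add_mem_cancel_right (hle hz)).mp hP))
    rw [show (b * x + c * w) * g₁ = b * (x * g₁) + c * (w * g₁) by ring]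
    exact add_mem (Ideal.mul_mem_left _ _ hx) (Ideal.mul_mem_left _ _ hw)

end Regular

theorem frobPow_eq_map_frobenius {R : Type} [CommRing R] (p : ℕ) [ExpChar R p] (a : Ideal R) :
    frobPow p a = a.map (frobenius R p) :=
  rfl

open MvPowerSeries in
theorem mem_P32_of_mul_G1_mem (k : Type) [Field k] (a : MvPowerSeries (Fin 6) k)
    (h : a * G1 k ∈ P32 k) : a ∈ P32 k := by
  unfold P32 px pw at *
  rw [← killVars_pair_eq_zero_iff] at h ⊢
  rw [map_mul, mul_eq_zero] at h
  refine h.resolve_right fun h0 => ?_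
  rw [G1, py, pt, pz, ps, map_sub, map_mul, map_mul,
    killVars_X_of_notMem (by simp), killVars_X_of_notMem (by simp),
    killVars_X_of_notMem (by simp), killVars_X_of_notMem (by simp), sub_eq_zero] at h0
  rcases (prime_X 1).dvd_or_dvd (Dvd.intro _ h0) with h1 | h1 <;>
    exact absurd (X_dvd_X_iff.mp h1) (by decide)

theorem mem_span_pow_of_mul_G1_pow_mem (k : Type) [Field k] (m n : ℕ) :
    ∀ a, a * G1 k ^ m ∈ Ideal.span {px k ^ n, pw k ^ n} →
      a ∈ Ideal.span {px k ^ n, pw k ^ n} := by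
  have hx : Prime (px k) := MvPowerSeries.prime_X 0
  have hw : Prime (pw k) := MvPowerSeries.prime_X 3
  have hxw : ¬ px k ∣ pw k := fun h => absurd (MvPowerSeries.X_dvd_X_iff.mp h) (by decide)
  have hwx : ¬ pw k ∣ px k := fun h => absurd (MvPowerSeries.X_dvd_X_iff.mp h) (by decide)
  refine mem_of_mul_pow_mem ?_ m
  rw [Set.pair_comm]
  refine mem_span_pow_pair_of_mul_mem (fun u => hx.pow_dvd_of_dvd_mul_left n hxw) ?_ n
  rw [Set.pair_comm]
  refine mem_span_pow_pair_of_mul_mem (fun u h => (hw.dvd_or_dvd h).resolve_left hwx) ?_ n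
  exact mem_P32_of_mul_G1_mem k

/-- With `K = (G₃, G₂)`, one has `K = I ∩ P` and `K^{[p]} = I^{[p]} ∩ P^{[p]}`. -/
theorem stmt10 (p : ℕ) (hp : p.Prime) (k : Type) [Field k] [CharP k p] :
    Ideal.span {G3 k, G2 k} = I32 k ⊓ P32 k ∧
    frobPow p (Ideal.span {G3 k, G2 k}) = frobPow p (I32 k) ⊓ frobPow p (P32 k) := by
  have h₂ : G2 k ∈ P32 k := Ideal.mem_span_pair.mpr ⟨pt k, -pz k, by rw [G2]; ring⟩
  have h₃ : G3 k ∈ P32 k := Ideal.mem_span_pair.mpr ⟨ps k, -py k, by rw [G3]; ring⟩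
  have hx : px k * G1 k ∈ Ideal.span {G3 k, G2 k} :=
    Ideal.mem_span_pair.mpr ⟨-pz k, py k, by rw [G1, G2, G3]; ring⟩
  have hw : pw k * G1 k ∈ Ideal.span {G3 k, G2 k} :=
    Ideal.mem_span_pair.mpr ⟨-pt k, ps k, by rw [G1, G2, G3]; ring⟩
  refine ⟨span_pair_eq_span_triple_inf h₂ h₃ hx hw (mem_P32_of_mul_G1_mem k), ?_⟩
  have : CharP (MvPowerSeries (Fin 6) k) p :=
    charP_of_injective_ringHom (MvPowerSeries.C_injective (σ := Fin 6) (R := k)) p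
  have : ExpChar (MvPowerSeries (Fin 6) k) p := ExpChar.prime hp
  rw [P32] at h₂ h₃
  apply Ideal.mem_map_of_mem (frobenius _ p) at h₂
  apply Ideal.mem_map_of_mem (frobenius _ p) at h₃
  apply Ideal.mem_map_of_mem (frobenius _ p) at hx
  apply Ideal.mem_map_of_mem (frobenius _ p) at hw
  simp only [frobPow_eq_map_frobenius, I32, P32, Ideal.map_span, Set.image_insert_eq,
    Set.image_singleton, map_mul] at h₂ h₃ hx hw ⊢
  exact span_pair_eq_span_triple_inf h₂ h₃ hx hw (mem_span_pow_of_mul_G1_pow_mem k p p)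
end

section
/- Setting u = (G_3 G_2)^{p−1} = ((xs − yw)(xt − zw))^{p−1} in R = k[[x, y, z, w, s, t]], one has u·I ⊆ I^{[p]} and u·Ω ⊆ Ω^{[p]}. -/
theorem pow_mem_frobPow {R : Type} [CommRing R] {q : ℕ} {a : Ideal R} {r : R} (h : r ∈ a) :
    r ^ q ∈ frobPow q a :=
  Ideal.subset_span ⟨r, h, rfl⟩

theorem frobPow_mono {R : Type} [CommRing R] {q : ℕ} {a b : Ideal R} (h : a ≤ b) :
    frobPow q a ≤ frobPow q b :=
  Ideal.span_mono (Set.image_mono h)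

/-- If `m + n ≤ l + 1` then `(x, w)^l ⊆ (x^m, w^n)`. -/
theorem span_pair_pow_le {R : Type} [CommRing R] (x w : R) {m n l : ℕ} (h : m + n ≤ l + 1) :
    Ideal.span {x, w} ^ l ≤ Ideal.span {x ^ m, w ^ n} := by
  rw [Ideal.span_insert, ← Ideal.add_eq_sup, add_pow, Ideal.sum_eq_sup]
  refine Finset.sup_le fun i hi => Ideal.mul_le_left.trans ?_
  rw [Ideal.span_singleton_pow, Ideal.span_singleton_pow, Ideal.span_singleton_mul_span_singleton,
    Ideal.span_singleton_le_iff_mem]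
  by_cases hm : m ≤ i
  · exact Ideal.mul_mem_right _ _ (Ideal.mem_of_dvd _ (pow_dvd_pow x hm)
      (Ideal.subset_span (by simp)))
  · exact Ideal.mul_mem_left _ _ (Ideal.mem_of_dvd _ (pow_dvd_pow w (by omega : n ≤ l - i))
      (Ideal.subset_span (by simp)))

/-- In characteristic `p`, the product of one minor with the `(p - 1)`-st powers of the other two
is a combination of the `p`-th powers of the three minors. -/
theorem minors_pow_mul_eq {R : Type} [CommRing R] [NoZeroDivisors R] {p : ℕ} (hp : p.Prime)
    [CharP R p] (x y z w s t : R) :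
    ∃ a b c : R, ((x * s - y * w) * (x * t - z * w)) ^ (p - 1) * (y * t - z * s) =
      a * (y * t - z * s) ^ p + b * (x * t - z * w) ^ p + c * (x * s - y * w) ^ p := by
  have := Fact.mk hp
  by_cases h0 : (x * s - y * w) * (x * t - z * w) = 0
  · refine ⟨0, 0, 0, ?_⟩
    rw [h0, zero_pow (by have := hp.two_le; omega)]
    ring
  obtain ⟨n, rfl⟩ : ∃ n, p = n + 1 := ⟨p - 1, by have := hp.pos; omega⟩
  refine ⟨(x * w) ^ n,
    y * s * ∑ i ∈ Finset.range n, (x * s) ^ i * (y * w) ^ (n - 1 - i),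
    -(z * t * ∑ i ∈ Finset.range n, (x * t) ^ i * (z * w) ^ (n - 1 - i)),
    mul_right_cancel₀ h0 ?_⟩
  have h₁ := (Commute.all (x * s) (y * w)).geom_sum₂_mul n
  have h₂ := (Commute.all (x * t) (z * w)).geom_sum₂_mul n
  have e₁ := sub_pow_char (p := n + 1) (y * t) (z * s)
  have e₂ := sub_pow_char (p := n + 1) (x * t) (z * w)
  have e₃ := sub_pow_char (p := n + 1) (x * s) (y * w)
  set S := ∑ i ∈ Finset.range n, (x * s) ^ i * (y * w) ^ (n - 1 - i)
  set T := ∑ i ∈ Finset.range n, (x * t) ^ i * (z * w) ^ (n - 1 - i)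
  calc ((x * s - y * w) * (x * t - z * w)) ^ (n + 1 - 1) * (y * t - z * s) *
        ((x * s - y * w) * (x * t - z * w))
      = (x * s - y * w) ^ (n + 1) * (x * t - z * w) ^ (n + 1) * (y * t - z * s) := by
        rw [Nat.add_sub_cancel, mul_pow]; ring
    _ = (x * w) ^ n * (y * t - z * s) ^ (n + 1) * ((x * s - y * w) * (x * t - z * w)) +
          y * s * (S * (x * s - y * w)) * (x * t - z * w) ^ (n + 1) * (x * t - z * w) -
          z * t * (T * (x * t - z * w)) * (x * s - y * w) ^ (n + 1) * (x * s - y * w) := by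
        rw [h₁, h₂, e₁, e₂, e₃]; ring
    _ = _ := by ring

theorem I32_pow_mul_mem (p : ℕ) (hp : p.Prime) (k : Type) [Field k] [CharP k p] :
    ∀ r ∈ I32 k,
      ((px k * ps k - py k * pw k) * (px k * pt k - pz k * pw k)) ^ (p - 1) * r ∈
        frobPow p (I32 k) := by
  have : CharP (MvPowerSeries (Fin 6) k) p :=
    charP_of_injective_algebraMap (algebraMap k (MvPowerSeries (Fin 6) k)).injective p
  have hp' : p - 1 + 1 = p := Nat.sub_add_cancel hp.pos
  have g₁ : G1 k ∈ I32 k := Ideal.subset_span (by simp)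
  have g₂ : G2 k ∈ I32 k := Ideal.subset_span (by simp)
  have g₃ : G3 k ∈ I32 k := Ideal.subset_span (by simp)
  change I32 k ≤ Submodule.comap
    (LinearMap.mulLeft (MvPowerSeries (Fin 6) k) _) (frobPow p (I32 k))
  conv_lhs => rw [I32]
  rw [Ideal.span_le]
  rintro _ (rfl | rfl | rfl)
  · obtain ⟨a, b, c, h⟩ := minors_pow_mul_eq hp (px k) (py k) (pz k) (pw k) (ps k) (pt k)
    change _ * G1 k ∈ frobPow p (I32 k)
    rw [G1, h]
    exact add_mem (add_mem (Ideal.mul_mem_left _ _ (pow_mem_frobPow g₁))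
      (Ideal.mul_mem_left _ _ (pow_mem_frobPow g₂))) (Ideal.mul_mem_left _ _ (pow_mem_frobPow g₃))
  · change (G3 k * G2 k) ^ (p - 1) * G2 k ∈ frobPow p (I32 k)
    rw [mul_pow, mul_assoc, ← pow_succ, hp']
    exact Ideal.mul_mem_left _ _ (pow_mem_frobPow g₂)
  · change (G3 k * G2 k) ^ (p - 1) * G3 k ∈ frobPow p (I32 k)
    rw [mul_pow, mul_right_comm, ← pow_succ, hp']
    exact Ideal.mul_mem_right _ _ (pow_mem_frobPow g₃)

theorem P32_pow_mul_mem (p : ℕ) (k : Type) [Field k] :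
    ∀ r ∈ P32 k,
      ((px k * ps k - py k * pw k) * (px k * pt k - pz k * pw k)) ^ (p - 1) * r ∈
        frobPow p (P32 k) := by
  intro r hr
  have hx : px k ∈ P32 k := Ideal.subset_span (by simp)
  have hw : pw k ∈ P32 k := Ideal.subset_span (by simp)
  have h₃ : px k * ps k - py k * pw k ∈ P32 k :=
    sub_mem (Ideal.mul_mem_right _ _ hx) (Ideal.mul_mem_left _ _ hw)
  have h₂ : px k * pt k - pz k * pw k ∈ P32 k :=
    sub_mem (Ideal.mul_mem_right _ _ hx) (Ideal.mul_mem_left _ _ hw)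
  have hu : ((px k * ps k - py k * pw k) * (px k * pt k - pz k * pw k)) ^ (p - 1) * r ∈
      P32 k ^ ((p - 1) + (p - 1) + 1) := by
    rw [mul_pow, pow_succ, pow_add]
    exact Ideal.mul_mem_mul (Ideal.mul_mem_mul (Ideal.pow_mem_pow h₃ _) (Ideal.pow_mem_pow h₂ _)) hr
  have hle : Ideal.span {px k ^ p, pw k ^ p} ≤ frobPow p (P32 k) := by
    rw [Ideal.span_le]
    rintro _ (rfl | rfl)
    exacts [pow_mem_frobPow hx, pow_mem_frobPow hw]
  exact hle (span_pair_pow_le (px k) (pw k) (by omega) hu)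

/-- With `u = (G₃G₂)^{p-1} = ((xs - yw)(xt - zw))^{p-1}`, one has `u·I ⊆ I^{[p]}` and
`u·Ω ⊆ Ω^{[p]}`. -/
theorem stmt11 (p : ℕ) (hp : p.Prime) (k : Type) [Field k] [CharP k p] :
    (∀ r ∈ I32 k,
      ((px k * ps k - py k * pw k) * (px k * pt k - pz k * pw k)) ^ (p - 1) * r ∈
        frobPow p (I32 k)) ∧
    (∀ r ∈ Om32 k,
      ((px k * ps k - py k * pw k) * (px k * pt k - pz k * pw k)) ^ (p - 1) * r ∈
        frobPow p (Om32 k)) := by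
  refine ⟨I32_pow_mul_mem p hp k, fun r hr => ?_⟩
  obtain ⟨a, ha, b, hb, rfl⟩ := Submodule.mem_sup.1 hr
  rw [mul_add]
  exact add_mem (frobPow_mono le_sup_left (I32_pow_mul_mem p hp k a ha))
    (frobPow_mono le_sup_right (P32_pow_mul_mem p k b hb))
end
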